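/- arXiv:1211.3903 — 9 statements merged into one kernel-verified Lean document; each statement's English description precedes it below -/
import Mathlib

section
/- Let (τ_n)_{n≥1} be a sequence in P^{1/2}_φ(M) and for each n let τ'_n : M' → M' be a dual map of τ_n, i.e. ⟨τ'_n(y')ζ, xζ⟩ = ⟨y'ζ, τ_n(x)ζ⟩ for all x ∈ M and y' ∈ M'. If for every y' ∈ M' the sequence (τ'_n(y')ζ)_{n≥1} is Cauchy in H, then for all f, g ∈ H one has sup_{x ∈ M, ‖x‖ ≤ 1} |⟨f, (τ_n(x) − τ_m(x)) g⟩| → 0 as m, n → ∞; i.e., for every functional of the form ψ(x) = ⟨f, x g⟩ the sequence ψ ∘ τ_n is Cauchy in the norm of functionals on M. -/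
open scoped ComplexOrder
open Filter Topology

noncomputable section

local notation "⟪" x ", " y "⟫" => @inner ℂ _ _ x y

variable {H : Type*} [NormedAddCommGroup H] [InnerProductSpace ℂ H] [CompleteSpace H]

/-- `ζ` is a cyclic vector for the von Neumann algebra `M`. -/
def IsCyclicVector (M : VonNeumannAlgebra H) (ζ : H) : Prop :=
  Dense (Submodule.span ℂ {v : H | ∃ x ∈ M, v = x ζ} : Set H)

/-- `ζ` is a separating vector for the von Neumann algebra `M`. -/
def IsSeparatingVector (M : VonNeumannAlgebra H) (ζ : H) : Prop :=
  ∀ x ∈ M, x ζ = 0 → x = 0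

/-- `τ` maps `M` into `M` and takes positive elements of `M` to positive operators. -/
def IsPositiveMapOn (M : VonNeumannAlgebra H)
    (τ : (H →L[ℂ] H) →ₗ[ℂ] (H →L[ℂ] H)) : Prop :=
  (∀ x ∈ M, τ x ∈ M) ∧ ∀ x ∈ M, x.IsPositive → (τ x).IsPositive

/-- Membership in `P^{1/2}_φ(M)` where `φ = ⟨ζ, · ζ⟩`: a positive map on `M` with
`τ(1) ≤ 1`, `φ ∘ τ ≤ φ` on positive elements, and `‖τ(x)ζ‖ ≤ ‖xζ‖`. -/
def MemPHalf (M : VonNeumannAlgebra H) (ζ : H)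
    (τ : (H →L[ℂ] H) →ₗ[ℂ] (H →L[ℂ] H)) : Prop :=
  IsPositiveMapOn M τ ∧ ((1 : H →L[ℂ] H) - τ 1).IsPositive ∧
    (∀ x ∈ M, x.IsPositive → ⟪ζ, τ x ζ⟫ ≤ ⟪ζ, x ζ⟫) ∧
    ∀ x ∈ M, ‖τ x ζ‖ ≤ ‖x ζ‖

/-- A separating vector for a von Neumann algebra is cyclic for its commutant. -/
theorem IsSeparatingVector.dense_commutant {M : VonNeumannAlgebra H} {ζ : H}
    (hsep : IsSeparatingVector M ζ) :
    Dense {v : H | ∃ y ∈ M.commutant, y ζ = v} := by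
  let L : Submodule ℂ H := M.commutant.toStarSubalgebra.toSubalgebra.toSubmodule.map
    (ContinuousLinearMap.apply ℂ H ζ).toLinearMap
  have hL : ∀ v, v ∈ L ↔ ∃ y ∈ M.commutant, y ζ = v := fun v => Iff.rfl
  let K := L.topologicalClosure
  have : CompleteSpace K := L.isClosed_topologicalClosure.completeSpace_coe
  have hmem : K.starProjection ∈ M := by
    refine (VonNeumannAlgebra.IsStarProjection.mem_iff isStarProjection_starProjection M).2
      fun y hy => ?_
    rw [Submodule.range_starProjection]
    refine Submodule.topologicalClosure_mem_invtSubmodule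
      ((Module.End.mem_invtSubmodule_iff_forall_mem_of_mem _).2 fun v hv => ?_)
    obtain ⟨z, hz, rfl⟩ := (hL v).1 hv
    exact (hL _).2 ⟨y * z, mul_mem hy hz, rfl⟩
  have hζK : K.starProjection ζ = ζ :=
    Submodule.starProjection_eq_self_iff.2
      (L.le_topologicalClosure ((hL ζ).2 ⟨1, one_mem _, rfl⟩))
  have hone : 1 - K.starProjection = 0 :=
    hsep _ (sub_mem (one_mem _) hmem) (by simp [hζK])
  intro v
  have hv : v ∈ K := by
    rw [← Submodule.starProjection_eq_self_iff, ← sub_eq_zero.1 hone]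
    rfl
  exact hv

/-- A positive map on a von Neumann algebra with `τ 1 ≤ 1` has norm at most `3` on self-adjoint
elements. -/
theorem IsPositiveMapOn.norm_apply_le_of_isSelfAdjoint {M : VonNeumannAlgebra H}
    {τ : (H →L[ℂ] H) →ₗ[ℂ] (H →L[ℂ] H)} (hτ : IsPositiveMapOn M τ)
    (hτ1 : ((1 : H →L[ℂ] H) - τ 1).IsPositive) {a : H →L[ℂ] H} (ha : a ∈ M)
    (hsa : IsSelfAdjoint a) : ‖τ a‖ ≤ 3 * ‖a‖ := by
  have hsmul : ∀ c : ℂ, c • (1 : H →L[ℂ] H) ∈ M := fun c =>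
    SMulMemClass.smul_mem (S := StarSubalgebra ℂ (H →L[ℂ] H)) (s := M.toStarSubalgebra) c
      (one_mem M.toStarSubalgebra)
  have h1 : ∀ b : H →L[ℂ] H, b ∈ M → 0 ≤ b → 0 ≤ τ b := fun b hb h =>
    (ContinuousLinearMap.nonneg_iff_isPositive _).2
      (hτ.2 b hb ((ContinuousLinearMap.nonneg_iff_isPositive _).1 h))
  have hle1 : τ 1 ≤ 1 := sub_nonneg.1 ((ContinuousLinearMap.nonneg_iff_isPositive _).2 hτ1)
  have hn1 : ‖τ 1‖ ≤ 1 :=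
    (CStarAlgebra.norm_le_norm_of_nonneg_of_le (h1 1 (one_mem M) zero_le_one) hle1).trans
      ContinuousLinearMap.norm_id_le
  have halg : algebraMap ℝ (H →L[ℂ] H) ‖a‖ = (‖a‖ : ℂ) • (1 : H →L[ℂ] H) := by
    rw [Algebra.algebraMap_eq_smul_one, Complex.coe_smul]
  have hub := hsa.le_algebraMap_norm_self
  have hlb := hsa.neg_algebraMap_norm_le_self
  rw [halg] at hub hlb
  have hp := h1 _ (add_mem (hsmul ‖a‖) ha) (by simpa [add_comm] using sub_nonneg.2 hlb)
  have hm := h1 _ (sub_mem (hsmul ‖a‖) ha) (sub_nonneg.2 hub)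
  rw [map_add, map_smul] at hp
  rw [map_sub, map_smul] at hm
  have hs : ‖(‖a‖ : ℂ) • τ 1‖ ≤ ‖a‖ := by
    rw [norm_smul, Complex.norm_real, norm_norm]
    exact mul_le_of_le_one_right (norm_nonneg a) hn1
  have hle : (‖a‖ : ℂ) • τ 1 + τ a ≤ (‖a‖ : ℂ) • τ 1 + (‖a‖ : ℂ) • τ 1 := by
    gcongr
    exact sub_nonneg.1 hm
  have hb := CStarAlgebra.norm_le_norm_of_nonneg_of_le hp hle
  calc ‖τ a‖ = ‖((‖a‖ : ℂ) • τ 1 + τ a) - (‖a‖ : ℂ) • τ 1‖ := by rw [add_sub_cancel_left]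
    _ ≤ ‖(‖a‖ : ℂ) • τ 1 + τ a‖ + ‖(‖a‖ : ℂ) • τ 1‖ := norm_sub_le _ _
    _ ≤ 3 * ‖a‖ := by
      linarith [norm_add_le ((‖a‖ : ℂ) • τ 1) ((‖a‖ : ℂ) • τ 1)]

/-- A positive map on a von Neumann algebra with `τ 1 ≤ 1` has norm at most `6`. -/
theorem IsPositiveMapOn.norm_apply_le {M : VonNeumannAlgebra H}
    {τ : (H →L[ℂ] H) →ₗ[ℂ] (H →L[ℂ] H)} (hτ : IsPositiveMapOn M τ)
    (hτ1 : ((1 : H →L[ℂ] H) - τ 1).IsPositive) {x : H →L[ℂ] H} (hx : x ∈ M) :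
    ‖τ x‖ ≤ 6 * ‖x‖ := by
  have hsmul : ∀ (c : ℂ) (b : H →L[ℂ] H), b ∈ M → c • b ∈ M := fun c b hb =>
    SMulMemClass.smul_mem (S := StarSubalgebra ℂ (H →L[ℂ] H)) (s := M.toStarSubalgebra) c hb
  have hsmulR : ∀ (c : ℝ) (b : H →L[ℂ] H), b ∈ M → c • b ∈ M := fun c b hb => by
    simpa only [Complex.coe_smul] using hsmul c b hb
  have hre : (realPart x : H →L[ℂ] H) ∈ M := by
    rw [realPart_apply_coe]
    exact hsmulR _ _ (add_mem hx (star_mem hx))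
  have him : (imaginaryPart x : H →L[ℂ] H) ∈ M := by
    rw [imaginaryPart_apply_coe]
    exact hsmul _ _ (hsmulR _ _ (sub_mem hx (star_mem hx)))
  have h1 := hτ.norm_apply_le_of_isSelfAdjoint hτ1 hre (realPart x).2
  have h2 := hτ.norm_apply_le_of_isSelfAdjoint hτ1 him (imaginaryPart x).2
  have h3 : ‖(realPart x : H →L[ℂ] H)‖ ≤ ‖x‖ := realPart.norm_le x
  have h4 : ‖(imaginaryPart x : H →L[ℂ] H)‖ ≤ ‖x‖ := imaginaryPart.norm_le x
  calc ‖τ x‖ = ‖τ (realPart x) + Complex.I • τ (imaginaryPart x)‖ := by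
        rw [← map_smul, ← map_add, realPart_add_I_smul_imaginaryPart]
    _ ≤ ‖τ (realPart x)‖ + ‖Complex.I • τ (imaginaryPart x)‖ := norm_add_le _ _
    _ ≤ 6 * ‖x‖ := by
      rw [norm_smul, Complex.norm_I]
      linarith

/-- Every vector is approximated by elements of a dense set, with error less than `ε` after scaling
by `C`. -/
theorem Dense.exists_norm_sub_mul_lt {E : Type*} [SeminormedAddCommGroup E] {s : Set E}
    (hs : Dense s) (v : E) {C ε : ℝ} (hC : 0 ≤ C) (hε : 0 < ε) : ∃ w ∈ s, ‖v - w‖ * C < ε := by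
  obtain ⟨w, hw, h⟩ := hs.exists_dist_lt v (show 0 < ε / (C + 1) by positivity)
  refine ⟨w, hw, ?_⟩
  rw [dist_eq_norm, lt_div_iff₀ (by positivity)] at h
  linarith [norm_nonneg (v - w)]

theorem stmt0 (M : VonNeumannAlgebra H) (ζ : H) (hζ : ‖ζ‖ = 1)
    (hcyc : IsCyclicVector M ζ) (hsep : IsSeparatingVector M ζ)
    (τ : ℕ → (H →L[ℂ] H) →ₗ[ℂ] (H →L[ℂ] H))
    (hτ : ∀ n, MemPHalf M ζ (τ n))
    (τ' : ℕ → (H →L[ℂ] H) →ₗ[ℂ] (H →L[ℂ] H))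
    (hτ'mem : ∀ n, ∀ y ∈ M.commutant, τ' n y ∈ M.commutant)
    (hdual : ∀ n, ∀ x ∈ M, ∀ y ∈ M.commutant, ⟪τ' n y ζ, x ζ⟫ = ⟪y ζ, τ n x ζ⟫)
    (hcauchy : ∀ y ∈ M.commutant, CauchySeq fun n => τ' n y ζ) :
    ∀ f g : H, ∀ ε > (0 : ℝ), ∃ N : ℕ, ∀ m ≥ N, ∀ n ≥ N, ∀ x ∈ M, ‖x‖ ≤ 1 →
      ‖⟪f, (τ n x - τ m x) g⟫‖ < ε := by
  intro f g ε hε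
  obtain ⟨_, ⟨y, hy, rfl⟩, hf⟩ := hsep.dense_commutant.exists_norm_sub_mul_lt f
    (show 0 ≤ 12 * ‖g‖ by positivity) (show 0 < ε / 3 by positivity)
  obtain ⟨_, ⟨z, hz, rfl⟩, hg⟩ := hsep.dense_commutant.exists_norm_sub_mul_lt g
    (show 0 ≤ 12 * ‖y ζ‖ by positivity) (show 0 < ε / 3 by positivity)
  have hw : star z * y ∈ M.commutant := mul_mem (star_mem hz) hy
  obtain ⟨N, hN⟩ := Metric.cauchySeq_iff.1 (hcauchy _ hw) (ε / 3) (by positivity)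
  refine ⟨N, fun m hm n hn x hx hx1 => ?_⟩
  set D := τ n x - τ m x with hD
  have hDM : D ∈ M := sub_mem ((hτ n).1.1 x hx) ((hτ m).1.1 x hx)
  have hDn : ‖D‖ ≤ 12 := by
    have h1 := (hτ n).1.norm_apply_le (hτ n).2.1 hx
    have h2 := (hτ m).1.norm_apply_le (hτ m).2.1 hx
    linarith [norm_sub_le (τ n x) (τ m x)]
  have hcore : ⟪y ζ, D (z ζ)⟫ = ⟪τ' n (star z * y) ζ - τ' m (star z * y) ζ, x ζ⟫ := by
    have hcomm : D (z ζ) = z (D ζ) :=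
      DFunLike.congr_fun (VonNeumannAlgebra.mem_commutant_iff.1 hz D hDM) ζ
    rw [hcomm, inner_sub_left, hdual n x hx _ hw, hdual m x hx _ hw, ← inner_sub_right,
      ContinuousLinearMap.star_eq_adjoint, mul_apply_eq_comp,
      ContinuousLinearMap.adjoint_inner_left, hD, sub_apply]
  have hsplit : ⟪f, D g⟫ = ⟪f - y ζ, D g⟫ + ⟪y ζ, D (g - z ζ)⟫ + ⟪y ζ, D (z ζ)⟫ := by
    rw [map_sub, inner_sub_left, inner_sub_right]
    ring
  have h1 : ‖⟪f - y ζ, D g⟫‖ < ε / 3 :=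
    calc _ ≤ ‖f - y ζ‖ * ‖D g‖ := norm_inner_le_norm _ _
      _ ≤ ‖f - y ζ‖ * (12 * ‖g‖) := by gcongr; exact D.le_of_opNorm_le hDn g
      _ < ε / 3 := hf
  have h2 : ‖⟪y ζ, D (g - z ζ)⟫‖ < ε / 3 :=
    calc _ ≤ ‖y ζ‖ * ‖D (g - z ζ)‖ := norm_inner_le_norm _ _
      _ ≤ ‖y ζ‖ * (12 * ‖g - z ζ‖) := by gcongr; exact D.le_of_opNorm_le hDn _
      _ = ‖g - z ζ‖ * (12 * ‖y ζ‖) := by ring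
      _ < ε / 3 := hg
  have h3 : ‖⟪y ζ, D (z ζ)⟫‖ < ε / 3 := by
    have hxζ : ‖x ζ‖ ≤ 1 := by simpa [hζ] using x.le_of_opNorm_le hx1 ζ
    have hd := hN n hn m hm
    rw [dist_eq_norm] at hd
    rw [hcore]
    exact ((norm_inner_le_norm _ _).trans
      (mul_le_of_le_one_right (norm_nonneg _) hxζ)).trans_lt hd
  rw [hsplit]
  linarith [norm_add₃_le (a := ⟪f - y ζ, D g⟫) (b := ⟪y ζ, D (g - z ζ)⟫) (c := ⟪y ζ, D (z ζ)⟫)]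
end
end

section
/- Let τ : M → M be a positive linear map with τ(1) ≤ 1 and φ(τ(x)) ≤ φ(x) for every positive x ∈ M. Then there exists a unique linear map τ' : M' → M' such that ⟨τ'(y')ζ, xζ⟩ = ⟨y'ζ, τ(x)ζ⟩ for all x ∈ M and y' ∈ M'; moreover τ' is positive, τ'(1) ≤ 1 and ⟨ζ, τ'(y')ζ⟩ ≤ ⟨ζ, y'ζ⟩ for every positive y' ∈ M'. Furthermore τ' ∈ P^{1/2}_φ(M') if and only if τ ∈ P^{1/2}_φ(M), i.e. ‖τ'(y')ζ‖ ≤ ‖y'ζ‖ for all y' ∈ M' if and only if ‖τ(x)ζ‖ ≤ ‖xζ‖ for all x ∈ M. -/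
open scoped ComplexOrder
open Filter Topology

noncomputable section

local notation "⟪" x ", " y "⟫" => @inner ℂ _ _ x y

variable {H : Type*} [NormedAddCommGroup H] [InnerProductSpace ℂ H] [CompleteSpace H]

namespace VonNeumannAlgebra

/-- A von Neumann algebra is spanned by its positive elements. -/
theorem mem_span_isPositive (M : VonNeumannAlgebra H) {x : H →L[ℂ] H} (hx : x ∈ M) :
    x ∈ Submodule.span ℂ {p : H →L[ℂ] H | p ∈ M ∧ p.IsPositive} := by
  have smul_mem : ∀ (c : ℂ) {z : H →L[ℂ] H}, z ∈ M → c • z ∈ M :=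
    fun c z hz => M.toStarSubalgebra.smul_mem hz c
  have selfAdjoint_case : ∀ h ∈ M, IsSelfAdjoint h →
      h ∈ Submodule.span ℂ {p : H →L[ℂ] H | p ∈ M ∧ p.IsPositive} := by
    intro h hM hsa
    have hone : (1 : H →L[ℂ] H) ∈ Submodule.span ℂ {p : H →L[ℂ] H | p ∈ M ∧ p.IsPositive} :=
      Submodule.subset_span ⟨one_mem M, ContinuousLinearMap.isPositive_one⟩
    have hshift : h + ((‖h‖ : ℝ) : ℂ) • (1 : H →L[ℂ] H) ∈
        Submodule.span ℂ {p : H →L[ℂ] H | p ∈ M ∧ p.IsPositive} := by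
      refine Submodule.subset_span ⟨add_mem hM (smul_mem _ (one_mem M)), ?_⟩
      rw [← ContinuousLinearMap.nonneg_iff_isPositive]
      have h1 := IsSelfAdjoint.neg_algebraMap_norm_le_self hsa
      rw [Algebra.algebraMap_eq_smul_one, neg_le_iff_add_nonneg] at h1
      rwa [Complex.coe_smul]
    simpa using Submodule.sub_mem _ hshift (Submodule.smul_mem _ ((‖h‖ : ℝ) : ℂ) hone)
  have hstar : star x ∈ M := star_mem hx
  have hre : (realPart x : H →L[ℂ] H) ∈ M := by
    rw [realPart_apply_coe, ← Complex.coe_smul]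
    exact smul_mem _ (add_mem hx hstar)
  have him : (imaginaryPart x : H →L[ℂ] H) ∈ M := by
    rw [imaginaryPart_apply_coe, ← Complex.coe_smul]
    exact smul_mem _ (smul_mem _ (sub_mem hx hstar))
  rw [← realPart_add_I_smul_imaginaryPart x]
  exact Submodule.add_mem _ (selfAdjoint_case _ hre (realPart x).2)
    (Submodule.smul_mem _ _ (selfAdjoint_case _ him (imaginaryPart x).2))

theorem mem_of_mem_span {M : VonNeumannAlgebra H} {x : H →L[ℂ] H}
    (hx : x ∈ Submodule.span ℂ {p : H →L[ℂ] H | p ∈ M ∧ p.IsPositive}) : x ∈ M := by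
  have hle : Submodule.span ℂ {p : H →L[ℂ] H | p ∈ M ∧ p.IsPositive} ≤
      M.toStarSubalgebra.toSubalgebra.toSubmodule := Submodule.span_le.mpr fun p hp => hp.1
  exact hle hx

/-- The map `x ↦ x ζ` on a von Neumann algebra. -/
def evalAt (M : VonNeumannAlgebra H) (ζ : H) : M.toStarSubalgebra →ₗ[ℂ] H :=
  (ContinuousLinearMap.apply ℂ H ζ).toLinearMap ∘ₗ M.toStarSubalgebra.subtype.toLinearMap

@[simp]
theorem evalAt_apply (M : VonNeumannAlgebra H) (ζ : H) (x : M.toStarSubalgebra) :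
    M.evalAt ζ x = (x : H →L[ℂ] H) ζ := rfl

theorem denseRange_evalAt {M : VonNeumannAlgebra H} {ζ : H} (h : IsCyclicVector M ζ) :
    DenseRange (M.evalAt ζ) := by
  refine Dense.mono ?_ h
  rw [← LinearMap.coe_range, SetLike.coe_subset_coe, Submodule.span_le]
  rintro _ ⟨x, hx, rfl⟩
  exact ⟨⟨x, hx⟩, rfl⟩

/-- A separating vector for `M` is cyclic for the commutant of `M`. -/
theorem denseRange_evalAt_commutant {M : VonNeumannAlgebra H} {ζ : H}
    (h : IsSeparatingVector M ζ) : DenseRange (M.commutant.evalAt ζ) := by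
  set K := (LinearMap.range (M.commutant.evalAt ζ)).topologicalClosure with hK
  have : CompleteSpace K := (Submodule.isClosed_topologicalClosure _).completeSpace_coe
  have hP : K.starProjection ∈ M := by
    rw [IsStarProjection.mem_iff isStarProjection_starProjection]
    intro y hy
    rw [Module.End.mem_invtSubmodule, Submodule.range_starProjection]
    refine Submodule.topologicalClosure_minimal _ ?_
      ((Submodule.isClosed_topologicalClosure _).preimage y.continuous)
    rintro _ ⟨z, rfl⟩
    exact Submodule.le_topologicalClosure _ ⟨⟨y * z, mul_mem hy z.2⟩, rfl⟩
  have hζ : ζ ∈ K := Submodule.le_topologicalClosure _ ⟨1, rfl⟩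
  have hzero := h (1 - K.starProjection) (sub_mem (one_mem M) hP)
    (by simp [Submodule.starProjection_eq_self_iff.mpr hζ])
  rw [DenseRange, ← LinearMap.coe_range, Submodule.dense_iff_topologicalClosure_eq_top, ← hK,
    eq_top_iff]
  intro v _
  rw [← Submodule.starProjection_eq_self_iff, ← sub_eq_zero.mp hzero]
  rfl

theorem eq_of_apply_eq {M : VonNeumannAlgebra H} {ζ : H} (h : IsCyclicVector M ζ)
    {S T : H →L[ℂ] H} (hS : S ∈ M.commutant) (hT : T ∈ M.commutant) (hST : S ζ = T ζ) :
    S = T := by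
  refine ContinuousLinearMap.coeFn_injective
    ((denseRange_evalAt h).equalizer S.continuous T.continuous (funext fun x => ?_))
  have h1 := DFunLike.congr_fun (mem_commutant_iff.mp hS _ x.2) ζ
  have h2 := DFunLike.congr_fun (mem_commutant_iff.mp hT _ x.2) ζ
  simp only [mul_apply_eq_comp] at h1 h2
  simp [← h1, ← h2, hST]

end VonNeumannAlgebra

/-- Vectors with the same inner products against a dense range are equal. -/
theorem DenseRange.ext_inner {V E : Type*} [NormedAddCommGroup V] [InnerProductSpace ℂ V]
    {e : E → V} (he : DenseRange e) {u v : V}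
    (h : ∀ a, ⟪u, e a⟫ = ⟪v, e a⟫) : u = v :=
  ext_inner_right ℂ fun w => he.induction_on w
    (isClosed_eq (by fun_prop) (by fun_prop)) h

/-- The norm of a vector can be estimated by its inner products against a dense range. -/
theorem DenseRange.norm_le_of_norm_inner_le {V E : Type*} [NormedAddCommGroup V] [InnerProductSpace ℂ V]
    {e : E → V} (he : DenseRange e) {u : V}
    {C : ℝ} (hC : 0 ≤ C) (h : ∀ a, ‖⟪u, e a⟫‖ ≤ C * ‖e a‖) : ‖u‖ ≤ C := by
  have key : ‖⟪u, u⟫‖ ≤ C * ‖u‖ := he.induction_on (p := fun w => ‖⟪u, w⟫‖ ≤ C * ‖w‖) u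
    (isClosed_le (by fun_prop) (by fun_prop)) h
  rw [inner_self_eq_norm_sq_to_K] at key
  rcases (norm_nonneg u).eq_or_lt with h0 | h0
  · rwa [← h0]
  · norm_num at key
    nlinarith

/-- A sesquilinear form that is bounded relative to a linear map with dense range is given by a
bounded operator. -/
theorem exists_inner_apply_eq_of_bounded {E : Type*} [AddCommGroup E] [Module ℂ E] {e : E →ₗ[ℂ] H}
    (he : DenseRange e) (B : E →ₗ⋆[ℂ] E →ₗ[ℂ] ℂ) {C : ℝ}
    (hB : ∀ a b, ‖B a b‖ ≤ C * ‖e a‖ * ‖e b‖) :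
    ∃ T : H →L[ℂ] H, ∀ a b, ⟪e a, T (e b)⟫ = B a b := by
  have hC0 : ∀ a, 0 ≤ C * ‖e a‖ := by
    intro a
    rcases (norm_nonneg (e a)).eq_or_lt with h0 | h0
    · simp [← h0]
    · have := (norm_nonneg _).trans (hB a a)
      nlinarith
  let t : E → H := fun a => (InnerProductSpace.toDual ℂ H).symm ((B a).extendOfNorm e)
  have ht : ∀ a b, ⟪t a, e b⟫ = B a b := fun a b => by
    rw [InnerProductSpace.toDual_symm_apply, LinearMap.extendOfNorm_eq he ⟨_, hB a⟩]
  let tl : E →ₗ[ℂ] H :=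
    { toFun := t
      map_add' := fun a b => he.ext_inner fun c => by simp [ht]
      map_smul' := fun r a => he.ext_inner fun c => by simp [ht, mul_comm] }
  have hbound : ∀ a, ‖tl a‖ ≤ C * ‖e a‖ := fun a => by
    refine he.norm_le_of_norm_inner_le (hC0 a) fun b => ?_
    exact (congrArg norm (ht a b)).le.trans (hB a b)
  refine ⟨ContinuousLinearMap.adjoint (tl.extendOfNorm e), fun a b => ?_⟩
  rw [ContinuousLinearMap.adjoint_inner_right, LinearMap.extendOfNorm_eq he ⟨C, hbound⟩]
  exact ht a b

namespace VonNeumannAlgebra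

theorem map_star_of_nonneg {M : VonNeumannAlgebra H} {ψ : (H →L[ℂ] H) →ₗ[ℂ] ℂ}
    (hψ : ∀ x ∈ M, x.IsPositive → 0 ≤ ψ x) {x : H →L[ℂ] H} (hx : x ∈ M) :
    ψ (star x) = star (ψ x) := by
  induction M.mem_span_isPositive hx using Submodule.span_induction with
  | mem p hp =>
    rw [hp.2.isSelfAdjoint.star_eq]
    exact (Complex.conj_eq_iff_im.mpr (Complex.nonneg_iff.mp (hψ p hp.1 hp.2)).2.symm).symm
  | zero => simp
  | add x y hx' hy' ihx ihy =>
    rw [star_add, map_add, map_add, ihx (mem_of_mem_span hx'), ihy (mem_of_mem_span hy'), star_add]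
  | smul c x hx' ih =>
    rw [star_smul, map_smul, map_smul, ih (mem_of_mem_span hx'), star_smul]

theorem conj_map_star_mul {M : VonNeumannAlgebra H} {ψ : (H →L[ℂ] H) →ₗ[ℂ] ℂ}
    (hψ : ∀ x ∈ M, x.IsPositive → 0 ≤ ψ x) {a b : H →L[ℂ] H} (ha : a ∈ M) (hb : b ∈ M) :
    (starRingEnd ℂ) (ψ (star b * a)) = ψ (star a * b) := by
  have := map_star_of_nonneg hψ (mul_mem (star_mem hb) ha)
  rw [star_mul, star_star] at this
  exact this.symm

/-- The sesquilinear form `(a, b) ↦ ψ (a⋆ b)` of a functional `ψ`. -/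
def sesqForm (M : VonNeumannAlgebra H) (ψ : (H →L[ℂ] H) →ₗ[ℂ] ℂ) :
    M.toStarSubalgebra →ₗ⋆[ℂ] M.toStarSubalgebra →ₗ[ℂ] ℂ :=
  LinearMap.mk₂'ₛₗ (starRingEnd ℂ) (RingHom.id ℂ)
    (fun a b => ψ (star (a : H →L[ℂ] H) * (b : H →L[ℂ] H)))
    (fun a a' b => by simp [add_mul])
    (fun r a b => by simp)
    (fun a b b' => by simp [mul_add])
    (fun r a b => by simp)

theorem sesqForm_apply (M : VonNeumannAlgebra H) (ψ : (H →L[ℂ] H) →ₗ[ℂ] ℂ)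
    (a b : M.toStarSubalgebra) :
    M.sesqForm ψ a b = ψ (star (a : H →L[ℂ] H) * (b : H →L[ℂ] H)) := rfl

/-- The Cauchy–Schwarz inequality for a positive functional. -/
theorem norm_sesqForm_mul_self_le {M : VonNeumannAlgebra H} {ψ : (H →L[ℂ] H) →ₗ[ℂ] ℂ}
    (hψ : ∀ x ∈ M, x.IsPositive → 0 ≤ ψ x) (a b : M.toStarSubalgebra) :
    ‖M.sesqForm ψ a b‖ * ‖M.sesqForm ψ a b‖ ≤
      (M.sesqForm ψ a a).re * (M.sesqForm ψ b b).re := by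
  have hsymm : ∀ a b, (starRingEnd ℂ) (M.sesqForm ψ b a) = M.sesqForm ψ a b := fun a b =>
    conj_map_star_mul hψ a.2 b.2
  let c : PreInnerProductSpace.Core ℂ M.toStarSubalgebra :=
    { inner := fun a b => M.sesqForm ψ a b
      conj_inner_symm := hsymm
      re_inner_nonneg := fun a => (Complex.nonneg_iff.mp
        (hψ _ (mul_mem (star_mem a.2) a.2) (ContinuousLinearMap.isPositive_adjoint_comp_self _))).1
      add_left := fun a b d => by simp
      smul_left := fun a b r => by simp }
  have key : ‖M.sesqForm ψ a b‖ * ‖M.sesqForm ψ b a‖ ≤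
      (M.sesqForm ψ a a).re * (M.sesqForm ψ b b).re :=
    InnerProductSpace.Core.inner_mul_inner_self_le (c := c) a b
  rwa [← hsymm b a, RCLike.norm_conj] at key

/-- An operator is positive if its quadratic form is nonnegative on a dense set. -/
theorem isPositive_of_denseRange {V E : Type*} [NormedAddCommGroup V]
    [InnerProductSpace ℂ V] {e : E → V} (he : DenseRange e) {T : V →L[ℂ] V}
    (h : ∀ a, 0 ≤ ⟪e a, T (e a)⟫) : T.IsPositive := by
  have hall : ∀ v, 0 ≤ ⟪v, T v⟫ := fun v =>
    he.induction_on (p := fun v => 0 ≤ ⟪v, T v⟫) v (isClosed_le (by fun_prop) (by fun_prop)) h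
  rw [ContinuousLinearMap.isPositive_iff_complex]
  intro v
  have hv : 0 ≤ ⟪T v, v⟫ := by
    rw [← inner_conj_symm]
    exact star_nonneg_iff.mpr (hall v)
  have := RCLike.nonneg_iff.mp hv
  exact ⟨RCLike.conj_eq_iff_re.mp (RCLike.conj_eq_iff_im.mpr this.2), this.1⟩

/-- A positive functional on `M` dominated by a multiple of a vector state with cyclic vector `ζ`
is implemented by a positive element of the commutant. -/
theorem exists_mem_commutant_of_le {M : VonNeumannAlgebra H} {ζ : H} (h : IsCyclicVector M ζ)
    {ψ : (H →L[ℂ] H) →ₗ[ℂ] ℂ} (hψ : ∀ x ∈ M, x.IsPositive → 0 ≤ ψ x) {C : ℝ} (hC0 : 0 ≤ C)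
    (hC : ∀ x ∈ M, x.IsPositive → ψ x ≤ C * ⟪ζ, x ζ⟫) :
    ∃ T ∈ M.commutant, T.IsPositive ∧ ((C : ℂ) • (1 : H →L[ℂ] H) - T).IsPositive ∧
      ∀ x ∈ M, ⟪T ζ, x ζ⟫ = ψ x := by
  have he := denseRange_evalAt h
  have hself : ∀ a : M.toStarSubalgebra,
      0 ≤ M.sesqForm ψ a a ∧ M.sesqForm ψ a a ≤ C * ⟪M.evalAt ζ a, M.evalAt ζ a⟫ := fun a => by
    have hp : (star (a : H →L[ℂ] H) * (a : H →L[ℂ] H)).IsPositive :=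
      ContinuousLinearMap.isPositive_adjoint_comp_self _
    have hm : star (a : H →L[ℂ] H) * (a : H →L[ℂ] H) ∈ M := mul_mem (star_mem a.2) a.2
    refine ⟨hψ _ hm hp, (hC _ hm hp).trans_eq ?_⟩
    rw [ContinuousLinearMap.star_eq_adjoint, mul_apply_eq_comp,
      ContinuousLinearMap.adjoint_inner_right]
    rfl
  have hre : ∀ a : M.toStarSubalgebra, 0 ≤ (M.sesqForm ψ a a).re ∧
      (M.sesqForm ψ a a).re ≤ C * ‖M.evalAt ζ a‖ ^ 2 := fun a => by
    obtain ⟨h1, h2⟩ := hself a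
    refine ⟨(Complex.le_def.mp h1).1, (Complex.le_def.mp h2).1.trans_eq ?_⟩
    rw [Complex.re_ofReal_mul, ← inner_self_eq_norm_sq (𝕜 := ℂ)]
    rfl
  have hbound : ∀ a b, ‖M.sesqForm ψ a b‖ ≤ C * ‖M.evalAt ζ a‖ * ‖M.evalAt ζ b‖ := fun a b => by
    refine abs_le_of_sq_le_sq' ?_ (by positivity) |>.2
    calc ‖M.sesqForm ψ a b‖ ^ 2 = ‖M.sesqForm ψ a b‖ * ‖M.sesqForm ψ a b‖ := sq _
      _ ≤ _ := norm_sesqForm_mul_self_le hψ a b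
      _ ≤ (C * ‖M.evalAt ζ a‖ ^ 2) * (C * ‖M.evalAt ζ b‖ ^ 2) :=
        mul_le_mul (hre a).2 (hre b).2 (hre b).1 (by positivity)
      _ = _ := by ring
  obtain ⟨T, hT⟩ := exists_inner_apply_eq_of_bounded he (M.sesqForm ψ) hbound
  have hTpos : T.IsPositive := isPositive_of_denseRange he fun a => by
    rw [hT]
    exact (hself a).1
  refine ⟨T, ?_, hTpos, ?_, fun x hx => ?_⟩
  · rw [mem_commutant_iff]
    intro g hg
    refine ContinuousLinearMap.coeFn_injective
      (he.equalizer (g * T).continuous (T * g).continuous (funext fun b => ?_))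
    refine he.ext_inner fun a => ?_
    have h1 := hT (star ⟨g, hg⟩ * a) b
    have h2 := hT a (⟨g, hg⟩ * b)
    simp only [sesqForm_apply, evalAt_apply, MulMemClass.coe_mul, StarMemClass.coe_star,
      mul_apply_eq_comp, star_mul, star_star, mul_assoc] at h1 h2
    rw [← h2, ContinuousLinearMap.star_eq_adjoint, ContinuousLinearMap.adjoint_inner_left] at h1
    simpa [inner_conj_symm] using congrArg (starRingEnd ℂ) h1
  · refine isPositive_of_denseRange he fun a => ?_
    have h1 := (hself a).2
    rw [← hT a a] at h1
    simpa [inner_sub_right, inner_smul_right] using h1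
  · have h1 := hT 1 ⟨x, hx⟩
    rw [← hTpos.isSelfAdjoint.adjoint_eq, ContinuousLinearMap.adjoint_inner_left]
    simpa [sesqForm_apply] using h1

theorem inner_apply_nonneg {M : VonNeumannAlgebra H} {x y : H →L[ℂ] H} (hx : x ∈ M)
    (hy : y ∈ M.commutant) (hxp : x.IsPositive) (hyp : y.IsPositive) (v : H) :
    0 ≤ ⟪y v, x v⟫ := by
  have hc : Commute y x := (mem_commutant_iff.mp hy x hx).symm
  have := Commute.mul_nonneg ((ContinuousLinearMap.nonneg_iff_isPositive y).mpr hyp)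
    ((ContinuousLinearMap.nonneg_iff_isPositive x).mpr hxp) hc
  have := ((ContinuousLinearMap.nonneg_iff_isPositive _).mp this).inner_nonneg_right v
  rwa [mul_apply_eq_comp, ← hyp.isSelfAdjoint.adjoint_eq,
    ContinuousLinearMap.adjoint_inner_right] at this

theorem eq_of_inner_apply_eq {M : VonNeumannAlgebra H} {ζ : H} (h : IsCyclicVector M ζ)
    {S T : H →L[ℂ] H} (hS : S ∈ M.commutant) (hT : T ∈ M.commutant)
    (hST : ∀ x ∈ M, ⟪S ζ, x ζ⟫ = ⟪T ζ, x ζ⟫) : S = T :=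
  eq_of_apply_eq h hS hT ((denseRange_evalAt h).ext_inner fun x => hST x x.2)

/-- The dual of a state-decreasing positive map, on one positive element of the commutant. -/
theorem exists_dual_of_isPositive {M : VonNeumannAlgebra H} {ζ : H} (hcyc : IsCyclicVector M ζ)
    {τ : (H →L[ℂ] H) →ₗ[ℂ] (H →L[ℂ] H)} (hpos : IsPositiveMapOn M τ)
    (hstate : ∀ x ∈ M, x.IsPositive → ⟪ζ, τ x ζ⟫ ≤ ⟪ζ, x ζ⟫) {y : H →L[ℂ] H}
    (hy : y ∈ M.commutant) (hyp : y.IsPositive) {C : ℝ} (hC0 : 0 ≤ C)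
    (hC : ((C : ℂ) • (1 : H →L[ℂ] H) - y).IsPositive) :
    ∃ T ∈ M.commutant, T.IsPositive ∧ ((C : ℂ) • (1 : H →L[ℂ] H) - T).IsPositive ∧
      ∀ x ∈ M, ⟪T ζ, x ζ⟫ = ⟪y ζ, τ x ζ⟫ := by
  refine exists_mem_commutant_of_le hcyc
    (ψ := (innerSL ℂ (y ζ)).toLinearMap ∘ₗ (ContinuousLinearMap.apply ℂ H ζ).toLinearMap ∘ₗ τ)
    (fun x hx hxp => inner_apply_nonneg (hpos.1 x hx) hy (hpos.2 x hx hxp) hyp ζ) hC0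
    fun x hx hxp => ?_
  have hC' : (C : ℂ) • (1 : H →L[ℂ] H) - y ∈ M.commutant :=
    sub_mem (M.commutant.toStarSubalgebra.smul_mem (one_mem M.commutant) _) hy
  have h1 := inner_apply_nonneg (hpos.1 x hx) hC' (hpos.2 x hx hxp) hC ζ
  have h2 : ⟪y ζ, τ x ζ⟫ ≤ C * ⟪ζ, τ x ζ⟫ := by
    simpa [inner_sub_left, inner_smul_left] using h1
  exact h2.trans (mul_le_mul_of_nonneg_left (hstate x hx hxp) (by exact_mod_cast hC0))

theorem isPositive_norm_sub {y : H →L[ℂ] H} (hy : y.IsPositive) :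
    (((‖y‖ : ℝ) : ℂ) • (1 : H →L[ℂ] H) - y).IsPositive := by
  have h := IsSelfAdjoint.le_algebraMap_norm_self hy.isSelfAdjoint
  rw [Algebra.algebraMap_eq_smul_one, ContinuousLinearMap.le_def] at h
  rwa [Complex.coe_smul]

theorem exists_dual_apply {M : VonNeumannAlgebra H} {ζ : H} (hcyc : IsCyclicVector M ζ)
    {τ : (H →L[ℂ] H) →ₗ[ℂ] (H →L[ℂ] H)} (hpos : IsPositiveMapOn M τ)
    (hstate : ∀ x ∈ M, x.IsPositive → ⟪ζ, τ x ζ⟫ ≤ ⟪ζ, x ζ⟫) {y : H →L[ℂ] H}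
    (hy : y ∈ M.commutant) :
    ∃ T ∈ M.commutant, ∀ x ∈ M, ⟪T ζ, x ζ⟫ = ⟪y ζ, τ x ζ⟫ := by
  induction M.commutant.mem_span_isPositive hy using Submodule.span_induction with
  | mem p hp =>
    obtain ⟨T, hT, -, -, h⟩ := exists_dual_of_isPositive hcyc hpos hstate hp.1 hp.2
      (norm_nonneg p) (isPositive_norm_sub hp.2)
    exact ⟨T, hT, h⟩
  | zero => exact ⟨0, zero_mem _, by simp⟩
  | add y z hy' hz' ihy ihz =>
    obtain ⟨S, hS, hSd⟩ := ihy (mem_of_mem_span hy')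
    obtain ⟨T, hT, hTd⟩ := ihz (mem_of_mem_span hz')
    exact ⟨S + T, add_mem hS hT, fun x hx => by simp [hSd x hx, hTd x hx]⟩
  | smul c y hy' ih =>
    obtain ⟨T, hT, hTd⟩ := ih (mem_of_mem_span hy')
    exact ⟨c • T, M.commutant.toStarSubalgebra.smul_mem hT c,
      fun x hx => by simp [hTd x hx]⟩

/-- A state-decreasing positive map on `M` has a dual map on the commutant. -/
theorem exists_dual {M : VonNeumannAlgebra H} {ζ : H} (hcyc : IsCyclicVector M ζ)
    {τ : (H →L[ℂ] H) →ₗ[ℂ] (H →L[ℂ] H)} (hpos : IsPositiveMapOn M τ)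
    (hstate : ∀ x ∈ M, x.IsPositive → ⟪ζ, τ x ζ⟫ ≤ ⟪ζ, x ζ⟫) :
    ∃ τ' : (H →L[ℂ] H) →ₗ[ℂ] (H →L[ℂ] H), (∀ y ∈ M.commutant, τ' y ∈ M.commutant) ∧
      ∀ x ∈ M, ∀ y ∈ M.commutant, ⟪τ' y ζ, x ζ⟫ = ⟪y ζ, τ x ζ⟫ := by
  choose t ht htd using fun y : M.commutant.toStarSubalgebra.toSubalgebra.toSubmodule =>
    exists_dual_apply hcyc hpos hstate y.2
  let tl : M.commutant.toStarSubalgebra.toSubalgebra.toSubmodule →ₗ[ℂ] (H →L[ℂ] H) :=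
    { toFun := t
      map_add' := fun y z => eq_of_inner_apply_eq hcyc (ht _) (add_mem (ht y) (ht z))
        fun x hx => by simp [htd _ x hx]
      map_smul' := fun c y => eq_of_inner_apply_eq hcyc (ht _)
        (M.commutant.toStarSubalgebra.smul_mem (ht y) c)
        fun x hx => by simp [htd _ x hx] }
  obtain ⟨τ', hτ'⟩ := LinearMap.exists_extend tl
  have key : ∀ y (hy : y ∈ M.commutant), τ' y = t ⟨y, hy⟩ := fun y hy =>
    DFunLike.congr_fun hτ' ⟨y, hy⟩
  exact ⟨τ', fun y hy => key y hy ▸ ht _, fun x hx y hy => key y hy ▸ htd _ x hx⟩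

end VonNeumannAlgebra

theorem stmt2 (M : VonNeumannAlgebra H) (ζ : H) (hζ : ‖ζ‖ = 1)
    (hcyc : IsCyclicVector M ζ) (hsep : IsSeparatingVector M ζ)
    (τ : (H →L[ℂ] H) →ₗ[ℂ] (H →L[ℂ] H))
    (hpos : IsPositiveMapOn M τ)
    (hunit : ((1 : H →L[ℂ] H) - τ 1).IsPositive)
    (hstate : ∀ x ∈ M, x.IsPositive → ⟪ζ, τ x ζ⟫ ≤ ⟪ζ, x ζ⟫) :
    ∃ τ' : (H →L[ℂ] H) →ₗ[ℂ] (H →L[ℂ] H),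
      (∀ y ∈ M.commutant, τ' y ∈ M.commutant) ∧
      (∀ x ∈ M, ∀ y ∈ M.commutant, ⟪τ' y ζ, x ζ⟫ = ⟪y ζ, τ x ζ⟫) ∧
      (∀ σ : (H →L[ℂ] H) →ₗ[ℂ] (H →L[ℂ] H),
        (∀ y ∈ M.commutant, σ y ∈ M.commutant) →
        (∀ x ∈ M, ∀ y ∈ M.commutant, ⟪σ y ζ, x ζ⟫ = ⟪y ζ, τ x ζ⟫) →
        ∀ y ∈ M.commutant, σ y = τ' y) ∧
      (∀ y ∈ M.commutant, y.IsPositive → (τ' y).IsPositive) ∧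
      ((1 : H →L[ℂ] H) - τ' 1).IsPositive ∧
      (∀ y ∈ M.commutant, y.IsPositive → ⟪ζ, τ' y ζ⟫ ≤ ⟪ζ, y ζ⟫) ∧
      ((∀ y ∈ M.commutant, ‖τ' y ζ‖ ≤ ‖y ζ‖) ↔ (∀ x ∈ M, ‖τ x ζ‖ ≤ ‖x ζ‖)) := by
  obtain ⟨τ', hmem, hdual⟩ := VonNeumannAlgebra.exists_dual hcyc hpos hstate
  have hex : ∀ y ∈ M.commutant, y.IsPositive → ∀ C : ℝ, 0 ≤ C →
      ((C : ℂ) • (1 : H →L[ℂ] H) - y).IsPositive →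
      (τ' y).IsPositive ∧ ((C : ℂ) • (1 : H →L[ℂ] H) - τ' y).IsPositive := by
    intro y hy hyp C hC0 hC
    obtain ⟨T, hT, hTp, hTC, hTd⟩ :=
      VonNeumannAlgebra.exists_dual_of_isPositive hcyc hpos hstate hy hyp hC0 hC
    have hτT : τ' y = T := VonNeumannAlgebra.eq_of_inner_apply_eq hcyc (hmem y hy) hT
      fun x hx => (hdual x hx y hy).trans (hTd x hx).symm
    rw [hτT]
    exact ⟨hTp, hTC⟩
  have hτpos : ∀ y ∈ M.commutant, y.IsPositive → (τ' y).IsPositive := fun y hy hyp =>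
    (hex y hy hyp ‖y‖ (norm_nonneg y) (VonNeumannAlgebra.isPositive_norm_sub hyp)).1
  refine ⟨τ', hmem, hdual, fun σ hσ hσd y hy => ?_, hτpos, ?_, fun y hy hyp => ?_,
    fun h x hx => ?_, fun h y hy => ?_⟩
  · exact VonNeumannAlgebra.eq_of_inner_apply_eq hcyc (hσ y hy) (hmem y hy)
      fun x hx => (hσd x hx y hy).trans (hdual x hx y hy).symm
  · simpa using (hex 1 (one_mem _) ContinuousLinearMap.isPositive_one 1 zero_le_one
      (by simp [ContinuousLinearMap.isPositive_zero])).2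
  · have h1 := VonNeumannAlgebra.inner_apply_nonneg (sub_mem (one_mem M) (hpos.1 1 (one_mem M)))
      hy hunit hyp ζ
    have h2 := hdual 1 (one_mem M) y hy
    have h3 : ∀ z : H →L[ℂ] H, z.IsPositive → ⟪ζ, z ζ⟫ = ⟪z ζ, ζ⟫ := fun z hz => by
      rw [← ContinuousLinearMap.adjoint_inner_left, hz.isSelfAdjoint.adjoint_eq]
    rw [h3 _ hyp, h3 _ (hτpos y hy hyp)]
    simp only [one_apply_eq_self] at h2
    rw [h2]
    simpa [inner_sub_right] using h1
  · refine (VonNeumannAlgebra.denseRange_evalAt_commutant hsep).norm_le_of_norm_inner_le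
      (norm_nonneg _) fun y => ?_
    rw [norm_inner_symm, VonNeumannAlgebra.evalAt_apply, ← hdual x hx y y.2, mul_comm]
    exact (norm_inner_le_norm _ _).trans
      (mul_le_mul_of_nonneg_right (h y y.2) (norm_nonneg _))
  · refine (VonNeumannAlgebra.denseRange_evalAt hcyc).norm_le_of_norm_inner_le
      (norm_nonneg _) fun x => ?_
    rw [VonNeumannAlgebra.evalAt_apply, hdual x x.2 y hy]
    exact (norm_inner_le_norm _ _).trans
      (mul_le_mul_of_nonneg_left (h x x.2) (norm_nonneg _))
end
end

section
/- Let τ₁, τ₂ : M → M be positive linear maps with τ_i(1) ≤ 1 and φ(τ_i(x)) ≤ φ(x) for all positive x ∈ M, and let τ'₁, τ'₂ : M' → M' be their dual maps, i.e. ⟨τ'_i(y')ζ, xζ⟩ = ⟨y'ζ, τ_i(x)ζ⟩ for all x ∈ M, y' ∈ M'. Then for all x ∈ M and y'₁, y'₂ ∈ M': |⟨y'₁ζ, (τ₁(x) − τ₂(x)) y'₂ζ⟩| ≤ ‖(τ'₁ − τ'₂)((y'₂)* y'₁)ζ‖ · ‖xζ‖ ≤ ‖(τ'₁ − τ'₂)((y'₂)*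 y'₁)ζ‖ · ‖x‖. -/
open scoped ComplexOrder
open Filter Topology

noncomputable section

local notation "⟪" x ", " y "⟫" => @inner ℂ _ _ x y

variable {H : Type*} [NormedAddCommGroup H] [InnerProductSpace ℂ H] [CompleteSpace H]

theorem stmt3 (M : VonNeumannAlgebra H) (ζ : H) (hζ : ‖ζ‖ = 1)
    (hcyc : IsCyclicVector M ζ) (hsep : IsSeparatingVector M ζ)
    (τ₁ τ₂ τ'₁ τ'₂ : (H →L[ℂ] H) →ₗ[ℂ] (H →L[ℂ] H))
    (hpos₁ : IsPositiveMapOn M τ₁) (hpos₂ : IsPositiveMapOn M τ₂)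
    (hunit₁ : ((1 : H →L[ℂ] H) - τ₁ 1).IsPositive)
    (hunit₂ : ((1 : H →L[ℂ] H) - τ₂ 1).IsPositive)
    (hstate₁ : ∀ x ∈ M, x.IsPositive → ⟪ζ, τ₁ x ζ⟫ ≤ ⟪ζ, x ζ⟫)
    (hstate₂ : ∀ x ∈ M, x.IsPositive → ⟪ζ, τ₂ x ζ⟫ ≤ ⟪ζ, x ζ⟫)
    (hmem₁ : ∀ y ∈ M.commutant, τ'₁ y ∈ M.commutant)
    (hmem₂ : ∀ y ∈ M.commutant, τ'₂ y ∈ M.commutant)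
    (hdual₁ : ∀ x ∈ M, ∀ y ∈ M.commutant, ⟪τ'₁ y ζ, x ζ⟫ = ⟪y ζ, τ₁ x ζ⟫)
    (hdual₂ : ∀ x ∈ M, ∀ y ∈ M.commutant, ⟪τ'₂ y ζ, x ζ⟫ = ⟪y ζ, τ₂ x ζ⟫) :
    ∀ x ∈ M, ∀ y₁ ∈ M.commutant, ∀ y₂ ∈ M.commutant,
      ‖⟪y₁ ζ, (τ₁ x - τ₂ x) (y₂ ζ)⟫‖ ≤ ‖(τ'₁ - τ'₂) (star y₂ * y₁) ζ‖ * ‖x ζ‖ ∧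
      ‖(τ'₁ - τ'₂) (star y₂ * y₁) ζ‖ * ‖x ζ‖ ≤ ‖(τ'₁ - τ'₂) (star y₂ * y₁) ζ‖ * ‖x‖ := by
  intro x hx y₁ hy₁ y₂ hy₂
  have h_comm : ∀ a ∈ M, ∀ v : H, a (y₂ v) = y₂ (a v) := fun a ha v =>
    DFunLike.congr_fun (VonNeumannAlgebra.mem_commutant_iff.mp hy₂ a ha) v
  have hy : star y₂ * y₁ ∈ M.commutant := mul_mem (star_mem hy₂) hy₁
  have key : ⟪y₁ ζ, (τ₁ x - τ₂ x) (y₂ ζ)⟫ = ⟪(τ'₁ - τ'₂) (star y₂ * y₁) ζ, x ζ⟫ := by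
    simp only [LinearMap.sub_apply, sub_apply, inner_sub_left, inner_sub_right]
    rw [hdual₁ x hx _ hy, hdual₂ x hx _ hy, h_comm _ (hpos₁.1 x hx), h_comm _ (hpos₂.1 x hx)]
    simp only [mul_apply_eq_comp, ContinuousLinearMap.star_eq_adjoint,
      ContinuousLinearMap.adjoint_inner_left]
  refine ⟨key ▸ norm_inner_le_norm _ _, ?_⟩
  gcongr
  simpa [hζ] using x.le_opNorm ζ
end
end

section
/- Let τ ∈ P^{1/2}_φ(M), let T be the unique contraction on H with T(xζ) = τ(x)ζ for x ∈ M, let P be the orthogonal projection onto {f ∈ H : T f = f}, let N = {x ∈ M : τ(x) = x}, and let E ∈ P^{1/2}_φ(M) be a map satisfying ⟨f, ((1/n)∑_{k=0}^{n−1} τ^k(x)) g⟩ → ⟨f, E(x) g⟩ for all f, g ∈ H and x ∈ M. Then P(xζ) = E(x)ζ for every x ∈ M, and the range of P equals the closure in H of the subspace spanned by {xζ : x ∈ N}. -/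
open scoped ComplexOrder
open Filter Topology

noncomputable section

local notation "⟪" x ", " y "⟫" => @inner ℂ _ _ x y

variable {H : Type*} [NormedAddCommGroup H] [InnerProductSpace ℂ H] [CompleteSpace H]

/-- The ergodic averages `s_n = (1/n) ∑_{k=0}^{n-1} τ^k` of an operator map `τ`. -/
def ergAvg (τ : Module.End ℂ (H →L[ℂ] H)) (n : ℕ) : Module.End ℂ (H →L[ℂ] H) :=
  (n : ℂ)⁻¹ • ∑ k ∈ Finset.range n, τ ^ k

/-- Powers of a map preserving `M` that is implemented by `T` on the vectors `x ζ` are implemented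
by the iterates of `T`. -/
theorem pow_mem_and_apply_eq_iterate {M : VonNeumannAlgebra H} {ζ : H}
    {τ : Module.End ℂ (H →L[ℂ] H)} {T : H →L[ℂ] H} (hτ : ∀ x ∈ M, τ x ∈ M)
    (hT : ∀ x ∈ M, T (x ζ) = τ x ζ) {x : H →L[ℂ] H} (hx : x ∈ M) (k : ℕ) :
    (τ ^ k) x ∈ M ∧ (τ ^ k) x ζ = T^[k] (x ζ) := by
  induction k with
  | zero => simpa using hx
  | succ k ih =>
    rw [pow_succ', Module.End.mul_apply, Function.iterate_succ_apply', ← ih.2, hT _ ih.1]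
    exact ⟨hτ _ ih.1, rfl⟩

/-- The ergodic averages of `τ`, applied to `ζ`, are the Birkhoff averages of `T`. -/
theorem ergAvg_apply_eq_birkhoffAverage {M : VonNeumannAlgebra H} {ζ : H}
    {τ : Module.End ℂ (H →L[ℂ] H)} {T : H →L[ℂ] H} (hτ : ∀ x ∈ M, τ x ∈ M)
    (hT : ∀ x ∈ M, T (x ζ) = τ x ζ) {x : H →L[ℂ] H} (hx : x ∈ M) (n : ℕ) :
    ergAvg τ n x ζ = birkhoffAverage ℂ T id n (x ζ) := by
  simp [ergAvg, birkhoffAverage, birkhoffSum, LinearMap.sum_apply,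
    fun k => (pow_mem_and_apply_eq_iterate hτ hT hx k).2]

theorem stmt6 (M : VonNeumannAlgebra H) (ζ : H) (hζ : ‖ζ‖ = 1)
    (hcyc : IsCyclicVector M ζ) (hsep : IsSeparatingVector M ζ)
    (τ : (H →L[ℂ] H) →ₗ[ℂ] (H →L[ℂ] H))
    (hτ : MemPHalf M ζ τ)
    (T : H →L[ℂ] H) (hTnorm : ‖T‖ ≤ 1) (hTdef : ∀ x ∈ M, T (x ζ) = τ x ζ)
    (P : H →L[ℂ] H)
    -- `P` is the orthogonal projection onto the closed subspace `{f : H | T f = f}`: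
    (hPran : ∀ f : H, T (P f) = P f)
    (hPorth : ∀ f w : H, T w = w → ⟪w, f - P f⟫ = 0)
    (E : (H →L[ℂ] H) →ₗ[ℂ] (H →L[ℂ] H)) (hE : MemPHalf M ζ E)
    (hEconv : ∀ f g : H, ∀ x ∈ M,
      Tendsto (fun n : ℕ => ⟪f, ergAvg τ n x g⟫) atTop (𝓝 ⟪f, E x g⟫)) :
    (∀ x ∈ M, P (x ζ) = E x ζ) ∧
    Set.range (P : H → H) =
      closure (Submodule.span ℂ {v : H | ∃ x ∈ M, τ x = x ∧ v = x ζ} : Set H) := by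
  have hτM := hτ.1.1
  have hfix : ∀ w : H, T w = w → P w = w := fun w hw => by
    have h := hPorth w (w - P w) (by rw [map_sub, hw, hPran])
    exact (sub_eq_zero.1 (inner_self_eq_zero.1 h)).symm
  have hproj : ∀ f : H,
      ((T.eqLocus (1 : H →L[ℂ] H)).orthogonalProjectionOnto f : H) = P f := fun f => by
    refine Submodule.eq_starProjection_of_mem_of_inner_eq_zero (hPran f) fun w hw => ?_
    rw [← inner_conj_symm, hPorth f w hw, map_zero]
  have hPE : ∀ x ∈ M, P (x ζ) = E x ζ := fun x hx => by
    refine ext_inner_left ℂ fun f => tendsto_nhds_unique ?_ (hEconv f ζ x hx)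
    have h := T.tendsto_birkhoffAverage_orthogonalProjection hTnorm (x ζ)
    rw [hproj] at h
    simpa only [ergAvg_apply_eq_birkhoffAverage hτM hTdef hx] using
      (tendsto_const_nhds (x := f)).inner h
  refine ⟨hPE, Set.Subset.antisymm ?_ ?_⟩
  · rintro _ ⟨f, rfl⟩
    refine map_mem_closure P.continuous (hcyc f) fun y hy => ?_
    induction hy using Submodule.span_induction with
    | mem y hy =>
      obtain ⟨x, hx, rfl⟩ := hy
      have hEx := hE.1.1 x hx
      refine Submodule.subset_span ⟨E x, hEx, ?_, hPE x hx⟩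
      refine sub_eq_zero.1 (hsep _ (sub_mem (hτM _ hEx) hEx) ?_)
      rw [sub_apply, ← hTdef _ hEx, ← hPE x hx, hPran, sub_self]
    | zero => simp
    | add y z _ _ hy hz => rw [map_add]; exact add_mem hy hz
    | smul c y _ hy => rw [map_smul]; exact Submodule.smul_mem _ c hy
  · have hrange : Set.range (P : H → H) = (T.eqLocus (1 : H →L[ℂ] H) : Set H) :=
      Set.Subset.antisymm (Set.range_subset_iff.2 hPran) fun w hw => ⟨w, hfix w hw⟩
    rw [hrange]
    refine closure_minimal (SetLike.coe_subset_coe.2 (Submodule.span_le.2 ?_))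
      (isClosed_eq T.continuous continuous_id)
    rintro _ ⟨x, hx, hτx, rfl⟩
    change T (x ζ) = x ζ
    rw [hTdef x hx, hτx]
end
end

section
/- Let τ ∈ P^{1/2}_φ(M), let N = {x ∈ M : τ(x) = x}, and let E ∈ P^{1/2}_φ(M) satisfy E ∘ E = E, E(M) ⊆ N, E(x) = x for x ∈ N, and ⟨f, ((1/n)∑_{k=0}^{n−1} τ^k(x)) g⟩ → ⟨f, E(x) g⟩ for all f, g ∈ H, x ∈ M. Then the following are equivalent: (i) 1 ∈ N and N is closed under products (so that N, being automatically self-adjoint, is a von Neumann subalgebra of M); (ii) E(1) = 1 and E satisfies the bimodule property y E(x) z = E(y x z) for all y, z ∈ N and x ∈ M. Moreover E(1) = 1 holds if and only if τ(1) = 1. -/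
open scoped ComplexOrder
open Filter Topology

noncomputable section

local notation "⟪" x ", " y "⟫" => @inner ℂ _ _ x y

variable {H : Type*} [NormedAddCommGroup H] [InnerProductSpace ℂ H] [CompleteSpace H]

/-- If adding any multiple of `u` to `v` never makes the norm smaller than that of the multiple,
then `u` and `v` are orthogonal. -/
theorem inner_eq_zero_of_forall_norm_smul_le {V : Type*} [NormedAddCommGroup V]
    [InnerProductSpace ℂ V] {u v : V} (h : ∀ t : ℂ, ‖t • u‖ ≤ ‖t • u + v‖) :
    inner ℂ u v = 0 := by
  by_contra hne
  have hpos : 0 < ‖inner ℂ u v‖ ^ 2 := by positivity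
  have key : ∀ s : ℝ, 0 ≤ 2 * s * ‖inner ℂ u v‖ ^ 2 + ‖v‖ ^ 2 := fun s => by
    have h1 := pow_le_pow_left₀ (norm_nonneg _) (h ((s : ℂ) * inner ℂ u v)) 2
    rw [@norm_add_sq ℂ, inner_smul_left, map_mul (starRingEnd ℂ), mul_assoc, Complex.conj_ofReal,
      Complex.conj_mul'] at h1
    have h2 : RCLike.re ((s : ℂ) * (‖inner ℂ u v‖ : ℂ) ^ 2) = s * ‖inner ℂ u v‖ ^ 2 := by
      norm_cast
    rw [h2] at h1
    linarith
  have h3 := key (-(‖v‖ ^ 2 + 1) / (2 * ‖inner ℂ u v‖ ^ 2))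
  have h4 : 2 * (-(‖v‖ ^ 2 + 1) / (2 * ‖inner ℂ u v‖ ^ 2)) * ‖inner ℂ u v‖ ^ 2
      = -(‖v‖ ^ 2 + 1) := by
    field_simp
  linarith

/-- A positive map on a von Neumann algebra preserves self-adjointness. -/
theorem IsPositiveMapOn.isSelfAdjoint_apply {M : VonNeumannAlgebra H}
    {τ : (H →L[ℂ] H) →ₗ[ℂ] (H →L[ℂ] H)} (hτ : IsPositiveMapOn M τ) {x : H →L[ℂ] H}
    (hxM : x ∈ M) (hx : IsSelfAdjoint x) : IsSelfAdjoint (τ x) := by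
  have h1 : (1 : H →L[ℂ] H) ∈ M := one_mem M
  have hc : ((‖x‖ : ℂ) • (1 : H →L[ℂ] H)) ∈ M := M.toStarSubalgebra.smul_mem h1 _
  have hpos : (x + (‖x‖ : ℂ) • (1 : H →L[ℂ] H)).IsPositive := by
    rw [← ContinuousLinearMap.nonneg_iff_isPositive]
    have := hx.neg_algebraMap_norm_le_self
    rw [Algebra.algebraMap_eq_smul_one, neg_le_iff_add_nonneg] at this
    simpa using this
  have hsa := (hτ.2 _ (add_mem hxM hc) hpos).isSelfAdjoint
  have hone := (hτ.2 1 h1 ContinuousLinearMap.isPositive_one).isSelfAdjoint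
  have hsc : IsSelfAdjoint ((‖x‖ : ℂ) • τ 1) :=
    IsSelfAdjoint.smul (Complex.conj_ofReal ‖x‖) hone
  simpa using hsa.sub hsc

/-- A positive map on a von Neumann algebra commutes with the adjoint. -/
theorem IsPositiveMapOn.map_star {M : VonNeumannAlgebra H}
    {τ : (H →L[ℂ] H) →ₗ[ℂ] (H →L[ℂ] H)} (hτ : IsPositiveMapOn M τ) {x : H →L[ℂ] H}
    (hx : x ∈ M) : τ (star x) = star (τ x) := by
  have hx' : star x ∈ M := star_mem hx
  have hre : ((realPart x : selfAdjoint (H →L[ℂ] H)) : H →L[ℂ] H) ∈ M := by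
    rw [realPart_apply_coe, ← Complex.coe_smul]
    exact M.toStarSubalgebra.smul_mem (add_mem hx hx') _
  have him : ((imaginaryPart x : selfAdjoint (H →L[ℂ] H)) : H →L[ℂ] H) ∈ M := by
    rw [imaginaryPart_apply_coe, ← Complex.coe_smul]
    exact M.toStarSubalgebra.smul_mem (M.toStarSubalgebra.smul_mem (sub_mem hx hx') _) _
  have h1 := (hτ.isSelfAdjoint_apply hre (realPart x).2).star_eq
  have h2 := (hτ.isSelfAdjoint_apply him (imaginaryPart x).2).star_eq
  have h3 := (realPart x).2.star_eq
  have h4 := (imaginaryPart x).2.star_eq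
  have hd := realPart_add_I_smul_imaginaryPart x
  rw [← hd]
  simp only [star_add, star_smul, map_add, map_smul, h1, h2, h3, h4]

/-- An idempotent element of `P^{1/2}_φ(M)` acts as an orthogonal projection on `M ζ`. -/
theorem MemPHalf.inner_apply_eq {M : VonNeumannAlgebra H} {ζ : H}
    {E : (H →L[ℂ] H) →ₗ[ℂ] (H →L[ℂ] H)} (hE : MemPHalf M ζ E)
    (hEE : ∀ x ∈ M, E (E x) = E x) {a x : H →L[ℂ] H} (ha : a ∈ M) (hEa : E a = a)
    (hx : x ∈ M) : ⟪a ζ, E x ζ⟫ = ⟪a ζ, x ζ⟫ := by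
  have h : ⟪a ζ, x ζ - E x ζ⟫ = 0 := by
    refine inner_eq_zero_of_forall_norm_smul_le fun t => ?_
    have := hE.2.2.2 (t • a + (x - E x))
      (add_mem (M.toStarSubalgebra.smul_mem ha t) (sub_mem hx (hE.1.1 x hx)))
    simpa [hEa, hEE x hx] using this
  rw [inner_sub_right, sub_eq_zero] at h
  exact h.symm

/-- An idempotent element of `P^{1/2}_φ(M)` whose fixed points are closed under products is
left modular over its fixed points. -/
theorem MemPHalf.map_mul_left {M : VonNeumannAlgebra H} {ζ : H}
    (hsep : IsSeparatingVector M ζ)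
    {E : (H →L[ℂ] H) →ₗ[ℂ] (H →L[ℂ] H)} (hE : MemPHalf M ζ E)
    (hEE : ∀ x ∈ M, E (E x) = E x)
    (hmul : ∀ y ∈ M, ∀ z ∈ M, E y = y → E z = z → E (y * z) = y * z)
    {y x : H →L[ℂ] H} (hy : y ∈ M) (hEy : E y = y) (hx : x ∈ M) :
    E (y * x) = y * E x := by
  have hEx := hE.1.1 x hx
  have hyx := mul_mem hy hx
  have hy' : star y ∈ M := star_mem hy
  have hEy' : E (star y) = star y := by rw [hE.1.map_star hy, hEy]
  set a := E (y * x) - y * E x with ha_def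
  have ha : a ∈ M := sub_mem (hE.1.1 _ hyx) (mul_mem hy hEx)
  have hEa : E a = a := by
    rw [ha_def, map_sub, hEE _ hyx, hmul y hy _ hEx hEy (hEE x hx)]
  have h1 := hE.inner_apply_eq hEE ha hEa hyx
  have h2 := hE.inner_apply_eq hEE (mul_mem hy' ha) (hmul _ hy' _ ha hEy' hEa) hx
  simp only [mul_apply_eq_comp, ContinuousLinearMap.star_eq_adjoint,
    ContinuousLinearMap.adjoint_inner_left] at h1 h2
  refine sub_eq_zero.mp (hsep a ha ?_)
  rw [← @inner_self_eq_zero ℂ]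
  calc ⟪a ζ, a ζ⟫ = ⟪a ζ, E (y * x) ζ - y (E x ζ)⟫ := rfl
    _ = 0 := by rw [inner_sub_right, h1, h2, sub_self]

theorem stmt7 (M : VonNeumannAlgebra H) (ζ : H) (hζ : ‖ζ‖ = 1)
    (hcyc : IsCyclicVector M ζ) (hsep : IsSeparatingVector M ζ)
    (τ : (H →L[ℂ] H) →ₗ[ℂ] (H →L[ℂ] H))
    (hτ : MemPHalf M ζ τ)
    (E : (H →L[ℂ] H) →ₗ[ℂ] (H →L[ℂ] H)) (hE : MemPHalf M ζ E)
    (hEE : ∀ x ∈ M, E (E x) = E x)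
    (hEran : ∀ x ∈ M, τ (E x) = E x)
    (hEfix : ∀ x ∈ M, τ x = x → E x = x)
    (hEconv : ∀ f g : H, ∀ x ∈ M,
      Tendsto (fun n : ℕ => ⟪f, ergAvg τ n x g⟫) atTop (𝓝 ⟪f, E x g⟫)) :
    ((τ (1 : H →L[ℂ] H) = 1 ∧
        ∀ y ∈ M, ∀ z ∈ M, τ y = y → τ z = z → τ (y * z) = y * z) ↔
      (E (1 : H →L[ℂ] H) = 1 ∧
        ∀ y ∈ M, ∀ z ∈ M, ∀ x ∈ M, τ y = y → τ z = z →
          y * E x * z = E (y * x * z))) ∧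
    (E (1 : H →L[ℂ] H) = 1 ↔ τ (1 : H →L[ℂ] H) = 1) := by
  have hE1 : E 1 = 1 ↔ τ 1 = 1 :=
    ⟨fun h => by simpa [h] using hEran 1 (one_mem M), hEfix 1 (one_mem M)⟩
  have hfix : ∀ x ∈ M, E x = x → τ x = x := fun x hx h => by simpa [h] using hEran x hx
  refine ⟨⟨?_, ?_⟩, hE1⟩
  · rintro ⟨h1, hmul⟩
    have hmulE : ∀ y ∈ M, ∀ z ∈ M, E y = y → E z = z → E (y * z) = y * z :=
      fun y hy z hz hEy hEz => hEfix _ (mul_mem hy hz)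
        (hmul y hy z hz (hfix y hy hEy) (hfix z hz hEz))
    refine ⟨hE1.2 h1, fun y hy z hz x hx hτy hτz => ?_⟩
    have hyx := mul_mem hy hx
    have hz' : star z ∈ M := star_mem hz
    have hyx' : star (y * x) ∈ M := star_mem hyx
    have hEz' : E (star z) = star z := by rw [hE.1.map_star hz, hEfix z hz hτz]
    have hleft := hE.map_mul_left hsep hEE hmulE hz' hEz' hyx'
    rw [← star_mul, hE.1.map_star (mul_mem hyx hz), hE.1.map_star hyx, ← star_mul] at hleft
    rw [star_injective hleft, hE.map_mul_left hsep hEE hmulE hy (hEfix y hy hτy) hx]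
  · rintro ⟨h1, hbi⟩
    refine ⟨hE1.1 h1, fun y hy z hz hτy hτz => hfix _ (mul_mem hy hz) ?_⟩
    simpa [h1] using (hbi y hy z hz 1 (one_mem M) hτy hτz).symm
end
end

section
/- Let τ : M → M be a positive linear map satisfying the Kadison–Schwarz inequality τ(x*)τ(x) ≤ τ(x*x) for all x ∈ M. Then for any fixed x ∈ M the following are equivalent: (i) τ(x*)τ(x) = τ(x*x); (ii) τ(x*)τ(y) = τ(x*y) for all y ∈ M. -/
open scoped ComplexOrder
open Filter Topology

noncomputable section

local notation "⟪" x ", " y "⟫" => @inner ℂ _ _ x y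

variable {H : Type*} [NormedAddCommGroup H] [InnerProductSpace ℂ H] [CompleteSpace H]

/-- If an affine real-linear function `c ↦ p + c a + c̄ b` on `ℂ` is everywhere nonnegative,
then its `c̄`-coefficient vanishes. -/
theorem eq_zero_of_forall_nonneg_add_mul_add_star_mul {p a b : ℂ}
    (h : ∀ c : ℂ, 0 ≤ p + c * a + star c * b) : b = 0 := by
  have h0 := Complex.nonneg_iff.1 (h 0)
  have h1 := Complex.nonneg_iff.1 (h 1)
  have h2 := Complex.nonneg_iff.1 (h Complex.I)
  simp at h0 h1 h2
  by_contra hb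
  have hn : 0 < Complex.normSq b := Complex.normSq_pos.2 hb
  have h3 := (Complex.nonneg_iff.1 (h (((-((p.re + 1) / Complex.normSq b) : ℝ) : ℂ) * b))).1
  have hre : a.re = b.re := by linarith
  have him : a.im = -b.im := by linarith
  obtain ⟨t, ht⟩ : ∃ t, t = (p.re + 1) / Complex.normSq b := ⟨_, rfl⟩
  have hmul : t * Complex.normSq b = p.re + 1 := by rw [ht]; field_simp
  rw [← ht] at h3
  simp [hre, him] at h3
  rw [Complex.normSq_apply] at hmul
  nlinarith

/-- The defect `τ (x* y) - τ (x*) τ y` of multiplicativity. -/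
def mulDefect (τ : (H →L[ℂ] H) →ₗ[ℂ] (H →L[ℂ] H)) (x y : H →L[ℂ] H) : H →L[ℂ] H :=
  τ (star x * y) - τ (star x) * τ y

theorem mulDefect_add_smul_self (τ : (H →L[ℂ] H) →ₗ[ℂ] (H →L[ℂ] H)) (x y : H →L[ℂ] H) (c : ℂ) :
    mulDefect τ (y + c • x) (y + c • x) = mulDefect τ y y + c • mulDefect τ y x +
      star c • mulDefect τ x y + (star c * c) • mulDefect τ x x := by
  simp only [mulDefect, star_add, star_smul, add_mul, mul_add, smul_mul_assoc, mul_smul_comm,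
    map_add, map_smul]
  module

theorem stmt8 (M : VonNeumannAlgebra H)
    (τ : (H →L[ℂ] H) →ₗ[ℂ] (H →L[ℂ] H))
    (hpos : IsPositiveMapOn M τ)
    -- Kadison–Schwarz inequality: `τ(x*)τ(x) ≤ τ(x*x)` for all `x ∈ M`.
    (hKS : ∀ x ∈ M, (τ (star x * x) - τ (star x) * τ x).IsPositive)
    (x : H →L[ℂ] H) (hx : x ∈ M) :
    τ (star x) * τ x = τ (star x * x) ↔
      ∀ y ∈ M, τ (star x) * τ y = τ (star x * y) := by
  constructor
  · intro h y hy
    have hxx : mulDefect τ x x = 0 := sub_eq_zero.2 h.symm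
    have hxy : mulDefect τ x y = 0 := by
      have hq : ∀ v : H, ⟪v, mulDefect τ x y v⟫ = 0 := by
        intro v
        refine eq_zero_of_forall_nonneg_add_mul_add_star_mul
          (p := ⟪v, mulDefect τ y y v⟫) (a := ⟪v, mulDefect τ y x v⟫) fun c => ?_
        have hmem : y + c • x ∈ M := add_mem hy (M.toStarSubalgebra.smul_mem hx c)
        have hp : (mulDefect τ (y + c • x) (y + c • x)).IsPositive := hKS _ hmem
        have hv := hp.inner_nonneg_right v
        rw [mulDefect_add_smul_self, hxx] at hv
        simpa [inner_add_right, inner_smul_right] using hv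
      have hz : ((mulDefect τ x y : H →L[ℂ] H) : H →ₗ[ℂ] H) = 0 := by
        refine (inner_map_self_eq_zero _).1 fun v => ?_
        exact inner_eq_zero_symm.1 (hq v)
      exact ContinuousLinearMap.coe_injective hz
    exact (sub_eq_zero.1 hxy).symm
  · exact fun h => h x hx
end
end

section
/- Let τ ∈ P^{KS}_φ(M), i.e. τ : M → M is a positive linear map with τ(x*)τ(x) ≤ τ(x*x) for all x ∈ M and φ(τ(x)) ≤ φ(x) for all positive x ∈ M, and let N = {x ∈ M : τ(x) = x}. Then the bimodule property holds: τ(y x z) = y τ(x) z for all y, z ∈ N and all x ∈ M. -/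
open scoped ComplexOrder
open Filter Topology

noncomputable section

local notation "⟪" x ", " y "⟫" => @inner ℂ _ _ x y

variable {H : Type*} [NormedAddCommGroup H] [InnerProductSpace ℂ H] [CompleteSpace H]

/-- A positive operator whose quadratic form vanishes at a vector kills that vector. -/
theorem ContinuousLinearMap.IsPositive.apply_eq_zero_of_inner_eq_zero {T : H →L[ℂ] H}
    (hT : T.IsPositive) {v : H} (hv : ⟪v, T v⟫ = 0) : T v = 0 := by
  obtain ⟨S, hS⟩ := CStarAlgebra.nonneg_iff_eq_star_mul_self.mp
    ((ContinuousLinearMap.nonneg_iff_isPositive T).mpr hT)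
  have hSv : S v = 0 := by
    rw [hS, mul_apply_eq_comp, ContinuousLinearMap.star_eq_adjoint,
      ContinuousLinearMap.adjoint_inner_right, inner_self_eq_zero] at hv
    exact hv
  rw [hS, mul_apply_eq_comp, hSv, map_zero]

/-- If `a + t b + t̄ c` is nonnegative for every complex `t`, then `b = 0`. -/
theorem Complex.eq_zero_of_forall_add_nonneg {a b c : ℂ}
    (h : ∀ t : ℂ, 0 ≤ a + t * b + star t * c) : b = 0 := by
  have key : ∀ d : ℂ, (∀ r : ℝ, 0 ≤ a + r * d) → d = 0 := by
    intro d hd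
    have h0 := (Complex.le_def.mp (hd 0)).2
    have h1 := (Complex.le_def.mp (hd 1)).2
    simp at h0 h1
    have him : d.im = 0 := by linarith
    refine Complex.ext ?_ him
    by_contra hre
    have h2 := (Complex.le_def.mp (hd (-(a.re + 1) / d.re))).1
    simp only [Complex.zero_re, Complex.add_re, Complex.mul_re, Complex.ofReal_re,
      Complex.ofReal_im, zero_mul, sub_zero, div_mul_cancel₀ _ hre] at h2
    linarith
  have h1 : b + c = 0 := key _ fun r => by
    convert h r using 1
    simp
    ring
  have h2 : Complex.I * (b - c) = 0 := key _ fun r => by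
    convert h (r * Complex.I) using 1
    simp
    ring
  have h3 : b - c = 0 := (mul_eq_zero.mp h2).resolve_left Complex.I_ne_zero
  linear_combination (h1 + h3) / 2

/-- A positive map on a von Neumann algebra preserves self-adjointness. -/
theorem IsPositiveMapOn.isSelfAdjoint {M : VonNeumannAlgebra H}
    {τ : (H →L[ℂ] H) →ₗ[ℂ] (H →L[ℂ] H)} (hτ : IsPositiveMapOn M τ) {x : H →L[ℂ] H}
    (hx : x ∈ M) (hsa : IsSelfAdjoint x) : IsSelfAdjoint (τ x) := by
  have hnonneg : ∀ y ∈ M, 0 ≤ y → IsSelfAdjoint (τ y) := fun y hy h0 =>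
    (hτ.2 y hy ((ContinuousLinearMap.nonneg_iff_isPositive y).mp h0)).isSelfAdjoint
  have hn : algebraMap ℝ (H →L[ℂ] H) ‖x‖ ∈ M := algebraMap_mem M.toStarSubalgebra (‖x‖ : ℂ)
  have h1 := hnonneg _ (add_mem hn hx)
    (neg_le_iff_add_nonneg'.mp hsa.neg_algebraMap_norm_le_self)
  have h2 := hnonneg _ hn (algebraMap_nonneg _ (norm_nonneg x))
  simpa using h1.sub h2

/-- Equality in the Kadison–Schwarz inequality at `y` puts `y` in the right multiplicative
domain of the map. -/
theorem map_mul_of_kadisonSchwarz_eq {M : VonNeumannAlgebra H}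
    {τ : (H →L[ℂ] H) →ₗ[ℂ] (H →L[ℂ] H)}
    (hKS : ∀ x ∈ M, (τ (star x * x) - τ (star x) * τ x).IsPositive)
    {x y : H →L[ℂ] H} (hx : x ∈ M) (hy : y ∈ M)
    (heq : τ (star y * y) = τ (star y) * τ y) : τ (x * y) = τ x * τ y := by
  have hx' : star x ∈ M := star_mem hx
  rw [← sub_eq_zero]
  set D : H →L[ℂ] H := τ (x * y) - τ x * τ y
  have hform : ∀ v, ⟪v, D v⟫ = 0 := by
    intro v
    refine Complex.eq_zero_of_forall_add_nonneg
      (a := ⟪v, (τ (x * star x) - τ x * τ (star x)) v⟫)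
      (c := ⟪v, (τ (star y * star x) - τ (star y) * τ (star x)) v⟫) fun t => ?_
    have h := (hKS _ (add_mem hx' (M.toStarSubalgebra.smul_mem hy t))).inner_nonneg_right v
    have hexp : τ (star (star x + t • y) * (star x + t • y))
          - τ (star (star x + t • y)) * τ (star x + t • y)
        = (τ (x * star x) - τ x * τ (star x)) + t • D
          + star t • (τ (star y * star x) - τ (star y) * τ (star x)) := by
      simp only [D, star_add, star_star, star_smul, add_mul, mul_add, smul_mul_assoc,
        mul_smul_comm, map_add, map_smul, heq]
      module
    rw [hexp] at h
    simpa only [add_apply, smul_apply, inner_add_right,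
      inner_smul_right] using h
  ext v
  have := (inner_map_self_eq_zero (D : H →ₗ[ℂ] H)).mp fun v => by
    rw [← inner_conj_symm]
    exact (congrArg _ (hform v)).trans (map_zero _)
  simpa using LinearMap.congr_fun this v

/-- The Kadison–Schwarz inequality is an equality at every fixed point of a positive map that
does not increase a faithful vector state. -/
theorem kadisonSchwarz_eq_of_fixed {M : VonNeumannAlgebra H} {ζ : H}
    (hsep : IsSeparatingVector M ζ) {τ : (H →L[ℂ] H) →ₗ[ℂ] (H →L[ℂ] H)}
    (hpos : IsPositiveMapOn M τ)
    (hKS : ∀ x ∈ M, (τ (star x * x) - τ (star x) * τ x).IsPositive)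
    (hstate : ∀ x ∈ M, x.IsPositive → ⟪ζ, τ x ζ⟫ ≤ ⟪ζ, x ζ⟫)
    {y : H →L[ℂ] H} (hy : y ∈ M) (hfix : τ y = y) :
    τ (star y * y) = τ (star y) * τ y := by
  have hfix' : τ (star y) = star y := by rw [hpos.map_star hy, hfix]
  have hyy : star y * y ∈ M := mul_mem (star_mem hy) hy
  have hD := hKS y hy
  rw [hfix, hfix'] at hD ⊢
  rw [← sub_eq_zero]
  refine hsep _ (sub_mem (hpos.1 _ hyy) hyy) (hD.apply_eq_zero_of_inner_eq_zero
    (le_antisymm ?_ (hD.inner_nonneg_right ζ)))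
  rw [sub_apply, inner_sub_right, sub_nonpos]
  exact hstate _ hyy ((ContinuousLinearMap.nonneg_iff_isPositive _).mp (star_mul_self_nonneg y))

theorem stmt10 (M : VonNeumannAlgebra H) (ζ : H) (hζ : ‖ζ‖ = 1)
    (hcyc : IsCyclicVector M ζ) (hsep : IsSeparatingVector M ζ)
    (τ : (H →L[ℂ] H) →ₗ[ℂ] (H →L[ℂ] H))
    (hpos : IsPositiveMapOn M τ)
    -- Kadison–Schwarz inequality: `τ(x*)τ(x) ≤ τ(x*x)` for all `x ∈ M`.
    (hKS : ∀ x ∈ M, (τ (star x * x) - τ (star x) * τ x).IsPositive)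
    -- `φ ∘ τ ≤ φ` on positive elements:
    (hstate : ∀ x ∈ M, x.IsPositive → ⟪ζ, τ x ζ⟫ ≤ ⟪ζ, x ζ⟫) :
    ∀ y ∈ M, ∀ z ∈ M, ∀ x ∈ M, τ y = y → τ z = z →
      τ (y * x * z) = y * τ x * z := by
  have hright : ∀ x ∈ M, ∀ z ∈ M, τ z = z → τ (x * z) = τ x * z := fun x hx z hz hfix => by
    rw [map_mul_of_kadisonSchwarz_eq hKS hx hz
      (kadisonSchwarz_eq_of_fixed hsep hpos hKS hstate hz hfix), hfix]
  intro y hy z hz x hx hfy hfz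
  have hfy' : τ (star y) = star y := by rw [hpos.map_star hy, hfy]
  have hleft : τ (y * x) = y * τ x := by
    have h := hright _ (star_mem hx) _ (star_mem hy) hfy'
    rw [← star_mul, hpos.map_star (mul_mem hy hx), hpos.map_star hx, ← star_mul] at h
    exact star_injective h
  rw [hright _ (mul_mem hy hx) z hz hfz, hleft]
end
end

section
/- Let τ : M → M be a positive linear map with τ(1) ≤ 1 and φ(τ(x)) ≤ φ(x) for all positive x ∈ M, and let τ' : M' → M' be its dual map, i.e. ⟨τ'(y')ζ, xζ⟩ = ⟨y'ζ, τ(x)ζ⟩ for all x ∈ M, y' ∈ M'. Fix n ≥ 1. Then τ is n-positive if and only if τ' is n-positive. -/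
open scoped ComplexOrder
open Filter Topology

noncomputable section

local notation "⟪" x ", " y "⟫" => @inner ℂ _ _ x y

variable {H : Type*} [NormedAddCommGroup H] [InnerProductSpace ℂ H] [CompleteSpace H]

/-- `σ` is `n`-positive on the von Neumann algebra `A`: for every `n × n` matrix
`(x i j)` with entries in `A` which is positive in the sense that
`∑ i j, ⟪h i, x i j (h j)⟫ ≥ 0` for all vectors `h`, the matrix `(σ (x i j))` is
positive in the same sense. -/
def IsNPositiveOn (n : ℕ) (A : VonNeumannAlgebra H)
    (σ : (H →L[ℂ] H) →ₗ[ℂ] (H →L[ℂ] H)) : Prop :=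
  ∀ x : Fin n → Fin n → (H →L[ℂ] H), (∀ i j, x i j ∈ A) →
    (∀ h : Fin n → H, 0 ≤ ∑ i, ∑ j, ⟪h i, x i j (h j)⟫) →
    ∀ h : Fin n → H, 0 ≤ ∑ i, ∑ j, ⟪h i, σ (x i j) (h j)⟫

/-- A vector separating for `M` is cyclic for the commutant of `M`. -/
theorem IsSeparatingVector.isCyclicVector_commutant {M : VonNeumannAlgebra H} {ζ : H}
    (hsep : IsSeparatingVector M ζ) : IsCyclicVector M.commutant ζ := by
  set S : Submodule ℂ H := Submodule.span ℂ {v : H | ∃ y ∈ M.commutant, v = y ζ}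
  set K : Submodule ℂ H := S.topologicalClosure
  have hKcomplete : CompleteSpace K := S.isClosed_topologicalClosure.completeSpace_coe
  have hmem : K.starProjection ∈ M := by
    rw [VonNeumannAlgebra.IsStarProjection.mem_iff isStarProjection_starProjection]
    intro y hy
    rw [Submodule.range_starProjection, Module.End.mem_invtSubmodule]
    have hSy : ∀ v ∈ S, y v ∈ S := by
      intro v hv
      induction hv using Submodule.span_induction with
      | mem v hv =>
        obtain ⟨z, hz, rfl⟩ := hv
        exact Submodule.subset_span ⟨y * z, mul_mem hy hz, rfl⟩
      | zero => simp
      | add u v _ _ hu hv => rw [map_add]; exact add_mem hu hv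
      | smul c v _ hv => rw [map_smul]; exact S.smul_mem c hv
    intro v hv
    exact map_mem_closure y.continuous hv hSy
  have hζK : ζ ∈ K :=
    S.le_topologicalClosure (Submodule.subset_span ⟨1, one_mem _, rfl⟩)
  have hproj : 1 - K.starProjection = 0 := by
    refine hsep _ (sub_mem (one_mem _) hmem) ?_
    simp [Submodule.starProjection_eq_self_iff.mpr hζK]
  have htop : K = ⊤ := by
    rw [eq_top_iff]
    intro v _
    rw [← Submodule.starProjection_eq_self_iff, ← sub_eq_zero.mp hproj]
    rfl
  exact Submodule.dense_iff_topologicalClosure_eq_top.mpr htop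

/-- If `ζ` is cyclic for `A`, the vectors `y ζ` with `y ∈ A` are dense. -/
theorem IsCyclicVector.dense_orbit {A : VonNeumannAlgebra H} {ζ : H}
    (hcyc : IsCyclicVector A ζ) : Dense {v : H | ∃ y ∈ A, v = y ζ} := by
  refine hcyc.mono fun v hv => ?_
  rw [SetLike.mem_coe] at hv
  induction hv using Submodule.span_induction with
  | mem v hv => exact hv
  | zero => exact ⟨0, zero_mem _, by simp⟩
  | add u v _ _ hu hv =>
    obtain ⟨y, hy, rfl⟩ := hu
    obtain ⟨z, hz, rfl⟩ := hv
    exact ⟨y + z, add_mem hy hz, rfl⟩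
  | smul c v _ hv =>
    obtain ⟨y, hy, rfl⟩ := hv
    exact ⟨c • y, A.toStarSubalgebra.smul_mem hy c, rfl⟩

/-- The adjoint of the `j`-th coordinate projection is the `j`-th inclusion. -/
theorem adjoint_piLp_proj_apply {ι : Type*} [Fintype ι] [DecidableEq ι] (j : ι) (u : H) :
    ContinuousLinearMap.adjoint (PiLp.proj 2 (𝕜 := ℂ) (fun _ : ι => H) j) u
      = PiLp.single 2 j u := by
  refine ext_inner_right ℂ fun v => ?_
  rw [ContinuousLinearMap.adjoint_inner_left, PiLp.inner_apply,
    Finset.sum_eq_single j (fun b _ hb => by simp [hb]) (by simp)]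
  simp

theorem PiLp.sum_single_apply {ι E : Type*} [Fintype ι] [DecidableEq ι] [NormedAddCommGroup E]
    (v : PiLp 2 (fun _ : ι => E)) : ∑ k, PiLp.single 2 k (v k) = v := by
  ext i
  simp [Pi.single_apply]

/-- A positive operator has a self-adjoint square root commuting with everything that commutes
with the operator. -/
theorem ContinuousLinearMap.exists_sqrt_commute {T : H →L[ℂ] H} (hT : 0 ≤ T) :
    ∃ S : H →L[ℂ] H, ContinuousLinearMap.adjoint S = S ∧ S * S = T ∧
      ∀ D, Commute T D → Commute S D :=
  ⟨CFC.sqrt T, (CFC.sqrt_nonneg T).isSelfAdjoint.star_eq, CFC.sqrt_mul_sqrt_self T,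
    fun _ hD => hD.cfcₙ_nnreal NNReal.sqrt⟩

/-- A positive matrix over a von Neumann algebra `A` has the form `s⋆ s` for a matrix `s`
over `A`. -/
theorem VonNeumannAlgebra.exists_matrix_eq_star_mul_self {n : ℕ} (A : VonNeumannAlgebra H)
    (x : Fin n → Fin n → (H →L[ℂ] H)) (hx : ∀ i j, x i j ∈ A)
    (hpos : ∀ h : Fin n → H, 0 ≤ ∑ i, ∑ j, ⟪h i, x i j (h j)⟫) :
    ∃ s : Fin n → Fin n → (H →L[ℂ] H), (∀ k i, s k i ∈ A) ∧
      ∀ i j, x i j = ∑ k, star (s k i) * s k j := by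
  let π := fun j : Fin n => PiLp.proj 2 (𝕜 := ℂ) (fun _ : Fin n => H) j
  let diag := fun f : Fin n → (PiLp 2 (fun _ : Fin n => H) →L[ℂ] H) =>
    (PiLp.continuousLinearEquiv 2 ℂ (fun _ : Fin n => H)).symm.toContinuousLinearMap ∘L
      ContinuousLinearMap.pi f
  let T := diag fun i => ∑ j, x i j ∘L π j
  have hT : ∀ v i, T v i = ∑ j, x i j (v j) := fun v i => by
    simp [T, diag, π]
  have hTpos : 0 ≤ T := by
    rw [ContinuousLinearMap.nonneg_iff_isPositive, ContinuousLinearMap.isPositive_iff_complex]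
    intro v
    have h0 : 0 ≤ ⟪T v, v⟫ := by
      rw [← inner_conj_symm, PiLp.inner_apply]
      simp_rw [hT, inner_sum]
      exact star_nonneg_iff.mpr (hpos fun i => v i)
    rw [Complex.nonneg_iff] at h0
    exact ⟨Complex.ext (by simp) (by simpa using h0.2), h0.1⟩
  obtain ⟨S, hSadj, hSS, hScomm⟩ := ContinuousLinearMap.exists_sqrt_commute hTpos
  have hentry : ∀ i j u, S (PiLp.single 2 j u) i
      = (π i ∘L S ∘L ContinuousLinearMap.adjoint (π j)) u := fun i j u => by
    simp [π, adjoint_piLp_proj_apply]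
  refine ⟨fun k i => π k ∘L S ∘L ContinuousLinearMap.adjoint (π i), fun k i => ?_, fun i j => ?_⟩
  · rw [← A.commutant_commutant, VonNeumannAlgebra.mem_commutant_iff]
    intro y hy
    let D := diag fun i => y ∘L π i
    have hD : ∀ v i, D v i = y (v i) := fun v i => by simp [D, diag, π]
    have hDsingle : ∀ i u, D (PiLp.single 2 i u) = PiLp.single 2 i (y u) := fun i u => by
      ext k
      rw [hD]
      by_cases hk : k = i
      · subst hk; simp
      · simp [hk]
    have hDT : Commute D T := by
      ext v k
      simp only [mul_apply_eq_comp, hD, hT, map_sum]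
      refine Finset.sum_congr rfl fun l _ => ?_
      exact (DFunLike.congr_fun (VonNeumannAlgebra.mem_commutant_iff.mp hy _ (hx k l)) (v l)).symm
    have hDS : S * D = D * S := hScomm D hDT.symm
    ext u
    have := congrArg (fun w : PiLp 2 (fun _ : Fin n => H) => w k)
      (DFunLike.congr_fun hDS (PiLp.single 2 i u))
    simp only [mul_apply_eq_comp, hDsingle, hD] at this
    simp only [mul_apply_eq_comp, ← hentry]
    exact this.symm
  · ext u
    have h1 : T (PiLp.single 2 j u) i = x i j u := by
      rw [hT, Finset.sum_eq_single j (fun b _ hb => by simp [hb]) (by simp)]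
      simp
    rw [← h1, ← hSS, mul_apply_eq_comp,
      ← PiLp.sum_single_apply (S (PiLp.single 2 j u)), map_sum]
    simp only [ContinuousLinearMap.star_eq_adjoint, ContinuousLinearMap.adjoint_comp,
      ContinuousLinearMap.adjoint_adjoint, hSadj, sum_apply,
      mul_apply_eq_comp, WithLp.ofLp_sum, Finset.sum_apply]
    refine Finset.sum_congr rfl fun k _ => ?_
    rw [hentry, hentry]
    rfl

/-- The pairing of a positive matrix over the commutant of `A` with a positive matrix over `A`
is nonnegative. -/
theorem VonNeumannAlgebra.sum_inner_nonneg {n : ℕ} (A : VonNeumannAlgebra H) (ζ : H)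
    (x z : Fin n → Fin n → (H →L[ℂ] H)) (hx : ∀ i j, x i j ∈ A)
    (hz : ∀ i j, z i j ∈ A.commutant)
    (hxpos : ∀ h : Fin n → H, 0 ≤ ∑ i, ∑ j, ⟪h i, x i j (h j)⟫)
    (hzpos : ∀ h : Fin n → H, 0 ≤ ∑ i, ∑ j, ⟪h i, z i j (h j)⟫) :
    0 ≤ ∑ i, ∑ j, ⟪z j i ζ, x i j ζ⟫ := by
  obtain ⟨s, hs, hxs⟩ := A.exists_matrix_eq_star_mul_self x hx hxpos
  have hterm : ∀ i j, ⟪z j i ζ, x i j ζ⟫ = ∑ k, star ⟪s k j ζ, z j i (s k i ζ)⟫ := by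
    intro i j
    rw [hxs, sum_apply, inner_sum]
    refine Finset.sum_congr rfl fun k _ => ?_
    rw [mul_apply_eq_comp, ContinuousLinearMap.star_eq_adjoint,
      ContinuousLinearMap.adjoint_inner_right]
    have hcomm : s k i (z j i ζ) = z j i (s k i ζ) :=
      DFunLike.congr_fun (VonNeumannAlgebra.mem_commutant_iff.mp (hz j i) _ (hs k i)) ζ
    rw [hcomm]
    exact (inner_conj_symm _ _).symm
  have hsum : ∑ i, ∑ j, ⟪z j i ζ, x i j ζ⟫
      = ∑ k, star (∑ j, ∑ i, ⟪s k j ζ, z j i (s k i ζ)⟫) := by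
    simp_rw [hterm, star_sum]
    rw [Finset.sum_comm]
    simp_rw [Finset.sum_comm (s := Finset.univ (α := Fin n)) (t := Finset.univ (α := Fin n))
      (f := fun i k => star ⟪s k _ ζ, z _ i (s k i ζ)⟫)]
    rw [Finset.sum_comm]
  rw [hsum]
  exact Finset.sum_nonneg fun k _ => star_nonneg_iff.mpr (hzpos fun i => s k i ζ)

/-- If `ρ` on the commutant of `A` is dual to `σ` on `A` and `ρ` is `n`-positive, then so is
`σ`. -/
theorem IsNPositiveOn.of_dual {n : ℕ} {A : VonNeumannAlgebra H} {ζ : H}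
    (hcyc : IsCyclicVector A.commutant ζ) {σ ρ : (H →L[ℂ] H) →ₗ[ℂ] (H →L[ℂ] H)}
    (hσ : ∀ x ∈ A, σ x ∈ A) (hρ : ∀ y ∈ A.commutant, ρ y ∈ A.commutant)
    (hdual : ∀ x ∈ A, ∀ y ∈ A.commutant, ⟪ρ y ζ, x ζ⟫ = ⟪y ζ, σ x ζ⟫)
    (hρpos : IsNPositiveOn n A.commutant ρ) : IsNPositiveOn n A σ := by
  intro x hx hxpos
  have hdense : Dense (Set.univ.pi fun _ : Fin n => {v : H | ∃ y ∈ A.commutant, v = y ζ}) :=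
    dense_pi _ fun _ _ => hcyc.dense_orbit
  have hclosed : IsClosed {h : Fin n → H | 0 ≤ ∑ i, ∑ j, ⟪h i, σ (x i j) (h j)⟫} :=
    isClosed_le (by fun_prop) (by fun_prop)
  suffices hsub : (Set.univ.pi fun _ : Fin n => {v : H | ∃ y ∈ A.commutant, v = y ζ}) ⊆
      {h : Fin n → H | 0 ≤ ∑ i, ∑ j, ⟪h i, σ (x i j) (h j)⟫} from
    fun h => hclosed.closure_subset_iff.mpr hsub (hdense h)
  intro h hh
  choose y hy hhy using fun i => hh i (Set.mem_univ i)
  obtain rfl : h = fun i => y i ζ := funext hhy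
  have hterm : ∀ i j, ⟪y i ζ, σ (x i j) (y j ζ)⟫ = ⟪ρ (star (y j) * y i) ζ, x i j ζ⟫ := by
    intro i j
    rw [hdual _ (hx i j) _ (mul_mem (star_mem (hy j)) (hy i)), mul_apply_eq_comp,
      ContinuousLinearMap.star_eq_adjoint, ContinuousLinearMap.adjoint_inner_left]
    have hcomm : σ (x i j) (y j ζ) = y j (σ (x i j) ζ) :=
      DFunLike.congr_fun (VonNeumannAlgebra.mem_commutant_iff.mp (hy j) _ (hσ _ (hx i j))) ζ
    rw [hcomm]
  change 0 ≤ ∑ i, ∑ j, ⟪y i ζ, σ (x i j) (y j ζ)⟫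
  simp_rw [hterm]
  have hymem : ∀ i j, star (y i) * y j ∈ A.commutant := fun i j =>
    mul_mem (star_mem (hy i)) (hy j)
  refine A.sum_inner_nonneg ζ x (fun i j => ρ (star (y i) * y j)) hx
    (fun i j => hρ _ (hymem i j)) hxpos (hρpos _ hymem fun h => ?_)
  have hgram : ∑ i, ∑ j, ⟪h i, (star (y i) * y j) (h j)⟫
      = ⟪∑ i, y i (h i), ∑ j, y j (h j)⟫ := by
    rw [sum_inner]
    simp_rw [inner_sum]
    simp [ContinuousLinearMap.star_eq_adjoint, ContinuousLinearMap.adjoint_inner_right]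
  rw [hgram, inner_self_eq_norm_sq_to_K]
  positivity

theorem stmt12 (M : VonNeumannAlgebra H) (ζ : H) (hζ : ‖ζ‖ = 1)
    (hcyc : IsCyclicVector M ζ) (hsep : IsSeparatingVector M ζ)
    (τ : (H →L[ℂ] H) →ₗ[ℂ] (H →L[ℂ] H))
    (hpos : IsPositiveMapOn M τ)
    (hunit : ((1 : H →L[ℂ] H) - τ 1).IsPositive)
    (hstate : ∀ x ∈ M, x.IsPositive → ⟪ζ, τ x ζ⟫ ≤ ⟪ζ, x ζ⟫)
    (τ' : (H →L[ℂ] H) →ₗ[ℂ] (H →L[ℂ] H))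
    (hmem : ∀ y ∈ M.commutant, τ' y ∈ M.commutant)
    (hdual : ∀ x ∈ M, ∀ y ∈ M.commutant, ⟪τ' y ζ, x ζ⟫ = ⟪y ζ, τ x ζ⟫)
    (n : ℕ) (hn : 1 ≤ n) :
    IsNPositiveOn n M τ ↔ IsNPositiveOn n M.commutant τ' := by
  have hcyc' := hsep.isCyclicVector_commutant
  refine ⟨fun h => ?_, fun h => IsNPositiveOn.of_dual hcyc' hpos.1 hmem hdual h⟩
  refine IsNPositiveOn.of_dual (ζ := ζ) (ρ := τ) ?_ hmem ?_ ?_ ?_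
  · rwa [VonNeumannAlgebra.commutant_commutant]
  · rw [VonNeumannAlgebra.commutant_commutant]
    exact hpos.1
  · rw [VonNeumannAlgebra.commutant_commutant]
    intro y hy x hx
    rw [← inner_conj_symm, ← hdual x hx y hy, inner_conj_symm]
  · rwa [VonNeumannAlgebra.commutant_commutant]
end
end

section
/- Let (τ_t)_{t≥0} be a semigroup of maps on M (τ_0 = id and τ_{s+t} = τ_s ∘ τ_t for s, t ≥ 0) such that each τ_t is linear, unital (τ_t(1) = 1), completely positive (for every n, all x_1, …, x_n ∈ M and h_1, …, h_n ∈ H, ∑_{i,j} ⟨h_i, τ_t(x_i^* x_j) h_j⟩ ≥ 0), leaves φ invariant (φ(τ_t(x)) = φ(x) for all x ∈ M, t ≥ 0), and such that t ↦ ⟨f, τ_t(x) g⟩ is continuous for all f, g ∈ H and x ∈ M. Let N = {x ∈ M : τ_t(x) = x for all t ≥ 0}. Then there exists a positive unital linear map E : M → M with E ∘ E = E, E(M) ⊆ N and E(x) = x for x ∈ N, such that for all f, g ∈ H: sup_{x ∈ M, ‖x‖ ≤ 1} |λ ∫_0^∞ e^{−λt} ⟨f, τ_t(x) g⟩ dt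 − ⟨f, E(x) g⟩| → 0 as λ → 0⁺. -/
open scoped ComplexOrder
open Filter Topology

noncomputable section

local notation "⟪" x ", " y "⟫" => @inner ℂ _ _ x y

variable {H : Type*} [NormedAddCommGroup H] [InnerProductSpace ℂ H] [CompleteSpace H]

open MeasureTheory

/-- The Abel mean `l ∫₀^∞ e^{-lt} u(t) dt` of a function on the half-line. -/
def abelMean (l : ℝ) (u : ℝ → ℂ) : ℂ :=
  (l : ℂ) * ∫ t in Set.Ioi (0 : ℝ), (Real.exp (-(l * t)) : ℂ) * u t

lemma integrableOn_exp_neg_mul {l : ℝ} (hl : 0 < l) (a : ℝ) :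
    IntegrableOn (fun t : ℝ => Real.exp (-(l * t))) (Set.Ioi a) := by
  simpa using integrableOn_exp_mul_Ioi (neg_lt_zero.2 hl) a

lemma mul_integral_exp_neg_mul {l : ℝ} (hl : 0 < l) :
    l * ∫ t in Set.Ioi (0 : ℝ), Real.exp (-(l * t)) = 1 := by
  have h := integral_exp_mul_Ioi (neg_lt_zero.2 hl) 0
  simp only [neg_mul, mul_zero, Real.exp_zero] at h
  rw [h]
  field_simp

lemma integrableOn_exp_neg_mul_mul {l : ℝ} (hl : 0 < l) {u : ℝ → ℂ} {c : ℝ}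
    (hu : ContinuousOn u (Set.Ici 0)) (hc : ∀ t, 0 ≤ t → ‖u t‖ ≤ c) :
    IntegrableOn (fun t : ℝ => (Real.exp (-(l * t)) : ℂ) * u t) (Set.Ioi 0) := by
  refine Integrable.mono' ((integrableOn_exp_neg_mul hl 0).mul_const c) ?_ ?_
  · refine ContinuousOn.aestronglyMeasurable ?_ measurableSet_Ioi
    exact (by fun_prop : Continuous fun t : ℝ => (Real.exp (-(l * t)) : ℂ)).continuousOn.mul
      (hu.mono Set.Ioi_subset_Ici_self)
  · filter_upwards [ae_restrict_mem measurableSet_Ioi] with t ht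
    rw [norm_mul, Complex.norm_real, Real.norm_eq_abs, Real.abs_exp]
    exact mul_le_mul_of_nonneg_left (hc t (le_of_lt ht)) (Real.exp_pos _).le

lemma abelMean_congr (l : ℝ) {u v : ℝ → ℂ} (h : ∀ t, 0 ≤ t → u t = v t) :
    abelMean l u = abelMean l v := by
  unfold abelMean
  congr 1
  refine setIntegral_congr_fun measurableSet_Ioi fun t ht => ?_
  simp only [h t (le_of_lt ht)]

lemma abelMean_const {l : ℝ} (hl : 0 < l) (c : ℂ) : abelMean l (fun _ => c) = c := by
  unfold abelMean
  rw [integral_mul_const, integral_complex_ofReal, ← mul_assoc, ← Complex.ofReal_mul,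
    mul_integral_exp_neg_mul hl, Complex.ofReal_one, one_mul]

lemma norm_abelMean_le {l : ℝ} (hl : 0 < l) {u : ℝ → ℂ} {c : ℝ}
    (hc : ∀ t, 0 ≤ t → ‖u t‖ ≤ c) : ‖abelMean l u‖ ≤ c := by
  have key : ‖∫ t in Set.Ioi (0 : ℝ), (Real.exp (-(l * t)) : ℂ) * u t‖ ≤
      ∫ t in Set.Ioi (0 : ℝ), Real.exp (-(l * t)) * c := by
    refine norm_integral_le_of_norm_le ((integrableOn_exp_neg_mul hl 0).mul_const c) ?_
    filter_upwards [ae_restrict_mem measurableSet_Ioi] with t ht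
    rw [norm_mul, Complex.norm_real, Real.norm_eq_abs, Real.abs_exp]
    exact mul_le_mul_of_nonneg_left (hc t (le_of_lt ht)) (Real.exp_pos _).le
  unfold abelMean
  rw [norm_mul, Complex.norm_real, Real.norm_eq_abs, abs_of_pos hl]
  calc _ ≤ l * ∫ t in Set.Ioi (0 : ℝ), Real.exp (-(l * t)) * c :=
        mul_le_mul_of_nonneg_left key hl.le
    _ = c := by rw [integral_mul_const, ← mul_assoc, mul_integral_exp_neg_mul hl, one_mul]

lemma abelMean_add {l : ℝ} (hl : 0 < l) {u v : ℝ → ℂ} {c d : ℝ}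
    (hu : ContinuousOn u (Set.Ici 0)) (hc : ∀ t, 0 ≤ t → ‖u t‖ ≤ c)
    (hv : ContinuousOn v (Set.Ici 0)) (hd : ∀ t, 0 ≤ t → ‖v t‖ ≤ d) :
    abelMean l (fun t => u t + v t) = abelMean l u + abelMean l v := by
  unfold abelMean
  simp only [mul_add]
  rw [integral_add (integrableOn_exp_neg_mul_mul hl hu hc)
    (integrableOn_exp_neg_mul_mul hl hv hd), mul_add]

lemma abelMean_const_mul (l : ℝ) (u : ℝ → ℂ) (a : ℂ) :
    abelMean l (fun t => a * u t) = a * abelMean l u := by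
  unfold abelMean
  simp only [mul_left_comm _ a]
  rw [integral_const_mul, mul_left_comm]

lemma abelMean_nonneg {l : ℝ} (hl : 0 < l) {u : ℝ → ℂ} (h : ∀ t, 0 ≤ t → 0 ≤ u t) :
    0 ≤ abelMean l u := by
  refine mul_nonneg (by exact_mod_cast hl.le) (integral_nonneg_of_ae ?_)
  filter_upwards [ae_restrict_mem measurableSet_Ioi] with t ht
  exact mul_nonneg (by exact_mod_cast (Real.exp_pos _).le) (h t (le_of_lt ht))

lemma norm_abelMean_sub_shift_le {l : ℝ} (hl : 0 < l) {u : ℝ → ℂ} {c s : ℝ} (hs : 0 ≤ s)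
    (hu : ContinuousOn u (Set.Ici 0)) (hc : ∀ t, 0 ≤ t → ‖u t‖ ≤ c) :
    ‖abelMean l (fun t => u t - u (t + s))‖ ≤ (l * s + (Real.exp (l * s) - 1)) * c := by
  have hc0 : 0 ≤ c := (norm_nonneg _).trans (hc 0 le_rfl)
  set F : ℝ → ℂ := fun t => (Real.exp (-(l * t)) : ℂ) * u t with hF
  have hFi : IntegrableOn F (Set.Ioi 0) := integrableOn_exp_neg_mul_mul hl hu hc
  have hFb : ∀ t, 0 ≤ t → ‖F t‖ ≤ Real.exp (-(l * t)) * c := fun t ht => by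
    rw [hF, norm_mul, Complex.norm_real, Real.norm_eq_abs, Real.abs_exp]
    exact mul_le_mul_of_nonneg_left (hc t ht) (Real.exp_pos _).le
  have hFs : IntegrableOn F (Set.Ioi s) := hFi.mono_set (Set.Ioi_subset_Ioi hs)
  have hshift : ∫ t in Set.Ioi (0 : ℝ), (Real.exp (-(l * t)) : ℂ) * u (t + s) =
      (Real.exp (l * s) : ℂ) * ∫ t in Set.Ioi s, F t := by
    rw [← integral_const_mul]
    have := (measurePreserving_add_right (volume : Measure ℝ) s).setIntegral_preimage_emb
      (measurableEmbedding_addRight s) (fun t => (Real.exp (l * s) : ℂ) * F t) (Set.Ioi s)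
    rw [← this]
    simp only [Set.preimage_add_const_Ioi, sub_self]
    refine setIntegral_congr_fun measurableSet_Ioi fun t _ => ?_
    simp only [hF]
    rw [← mul_assoc, ← Complex.ofReal_mul, ← Real.exp_add]
    congr 3
    ring
  have hus : ContinuousOn (fun t => u (t + s)) (Set.Ici 0) :=
    hu.comp (by fun_prop) fun t (ht : 0 ≤ t) => add_nonneg ht hs
  have hsi := integrableOn_exp_neg_mul_mul hl hus fun t ht => hc (t + s) (add_nonneg ht hs)
  have hsplit : ∫ t in Set.Ioi (0 : ℝ), F t = (∫ t in Set.Ioc 0 s, F t) + ∫ t in Set.Ioi s, F t := by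
    rw [← setIntegral_union (Set.Ioc_disjoint_Ioi le_rfl) measurableSet_Ioi
      (hFi.mono_set Set.Ioc_subset_Ioi_self) hFs, Set.Ioc_union_Ioi_eq_Ioi hs]
  have h1 : ‖∫ t in Set.Ioc 0 s, F t‖ ≤ s * c := by
    have := norm_setIntegral_le_of_norm_le_const (μ := volume) (s := Set.Ioc 0 s) (f := F) (C := c)
      (by simp) (fun t ht => (hFb t ht.1.le).trans (mul_le_of_le_one_left hc0
        (Real.exp_le_one_iff.2 (neg_nonpos.2 (mul_nonneg hl.le ht.1.le)))))
    simpa [Measure.real, hs, mul_comm] using this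
  have h2 : ‖(l : ℂ) * ∫ t in Set.Ioi s, F t‖ ≤ c := by
    rw [norm_mul, Complex.norm_real, Real.norm_eq_abs, abs_of_pos hl]
    have hb : ‖∫ t in Set.Ioi s, F t‖ ≤ ∫ t in Set.Ioi (0 : ℝ), Real.exp (-(l * t)) * c := by
      refine (norm_integral_le_of_norm_le ((integrableOn_exp_neg_mul hl s).mul_const c) ?_).trans ?_
      · filter_upwards [ae_restrict_mem measurableSet_Ioi] with t ht
        exact hFb t (hs.trans (le_of_lt ht))
      · refine setIntegral_mono_set ((integrableOn_exp_neg_mul hl 0).mul_const c) ?_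
          (Set.Ioi_subset_Ioi hs).eventuallyLE
        exact Eventually.of_forall fun t => mul_nonneg (Real.exp_pos _).le hc0
    calc _ ≤ l * ∫ t in Set.Ioi (0 : ℝ), Real.exp (-(l * t)) * c :=
          mul_le_mul_of_nonneg_left hb hl.le
      _ = c := by rw [integral_mul_const, ← mul_assoc, mul_integral_exp_neg_mul hl, one_mul]
  have hexp : 0 ≤ Real.exp (l * s) - 1 := sub_nonneg.2 (Real.one_le_exp (mul_nonneg hl.le hs))
  have heq : abelMean l (fun t => u t - u (t + s)) =
      (l : ℂ) * (∫ t in Set.Ioc 0 s, F t) -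
        ((Real.exp (l * s) - 1 : ℝ) : ℂ) * ((l : ℂ) * ∫ t in Set.Ioi s, F t) := by
    unfold abelMean
    simp only [mul_sub]
    rw [integral_sub hFi hsi, hshift, hsplit]
    push_cast
    ring
  rw [heq]
  refine (norm_sub_le _ _).trans ?_
  rw [norm_mul, norm_mul, Complex.norm_real, Complex.norm_real, Real.norm_eq_abs, Real.norm_eq_abs,
    abs_of_pos hl, abs_of_nonneg hexp, add_mul, mul_assoc]
  exact add_le_add (mul_le_mul_of_nonneg_left h1 hl.le) (mul_le_mul_of_nonneg_left h2 hexp)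

lemma apply_eq_self_of_adjoint_apply_eq_self {T : H →L[ℂ] H} (hT : ∀ v, ‖T v‖ ≤ ‖v‖) {v : H}
    (h : T.adjoint v = v) : T v = v := by
  have h1 : RCLike.re ⟪T v, v⟫ = ‖v‖ ^ 2 := by
    rw [← ContinuousLinearMap.adjoint_inner_right, h, inner_self_eq_norm_sq (𝕜 := ℂ)]
  have h2 := norm_sub_sq (𝕜 := ℂ) (T v) v
  rw [h1] at h2
  have h3 : ‖T v - v‖ ^ 2 ≤ 0 := by
    have := pow_le_pow_left₀ (norm_nonneg _) (hT v) 2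
    linarith
  exact sub_eq_zero.1 (norm_eq_zero.1 (pow_eq_zero_iff two_ne_zero |>.1 (h3.antisymm (sq_nonneg _))))

lemma adjoint_apply_eq_self_of_apply_eq_self {T : H →L[ℂ] H} (hT : ∀ v, ‖T v‖ ≤ ‖v‖) {v : H}
    (h : T v = v) : T.adjoint v = v := by
  refine apply_eq_self_of_adjoint_apply_eq_self (T := T.adjoint) (fun w => ?_) (by simpa using h)
  have h1 : ‖T‖ ≤ 1 := T.opNorm_le_bound zero_le_one (by simpa using hT)
  have h2 : ‖T.adjoint‖ ≤ 1 := by simpa using h1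
  exact (T.adjoint.le_of_opNorm_le h2 w).trans_eq (one_mul _)

/-- The subspace of vectors fixed by a one-parameter family of operators. -/
def fixedSubspace (T : ℝ → H →L[ℂ] H) : Submodule ℂ H where
  carrier := {v | ∀ t, 0 ≤ t → T t v = v}
  add_mem' ha hb t ht := by rw [map_add, ha t ht, hb t ht]
  zero_mem' t _ := map_zero _
  smul_mem' c v hv t ht := by rw [map_smul, hv t ht]

lemma isClosed_fixedSubspace (T : ℝ → H →L[ℂ] H) : IsClosed (fixedSubspace T : Set H) := by
  have : (fixedSubspace T : Set H) = ⋂ t, ⋂ (_ : 0 ≤ t), {v | T t v = v} := by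
    ext v
    simp [fixedSubspace]
  rw [this]
  exact isClosed_iInter fun t => isClosed_iInter fun _ =>
    isClosed_eq (T t).continuous continuous_id

instance (T : ℝ → H →L[ℂ] H) : CompleteSpace (fixedSubspace T) :=
  (isClosed_fixedSubspace T).completeSpace_coe

/-- The vectors against which the Abel means of a contraction semigroup converge weakly to the
projection onto the fixed vectors, uniformly on bounded subsets of `D`. -/
def abelSubspace (T : ℝ → H →L[ℂ] H) (D : Set H)
    (hT : ∀ t, 0 ≤ t → ∀ v, ‖T t v‖ ≤ ‖v‖)
    (hD : ∀ f, ∀ v ∈ D, ContinuousOn (fun t => ⟪f, T t v⟫) (Set.Ici 0)) : Submodule ℂ H where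
  carrier := {f | ∀ ε > (0 : ℝ), ∀ᶠ l in 𝓝[>] (0 : ℝ), ∀ v ∈ D,
    ‖abelMean l (fun t => ⟪f, T t v⟫) - ⟪(fixedSubspace T).starProjection f, v⟫‖ ≤ ε * ‖v‖}
  add_mem' {f g} hf hg ε hε := by
    filter_upwards [hf (ε / 2) (half_pos hε), hg (ε / 2) (half_pos hε), self_mem_nhdsWithin]
      with l h1 h2 (hl : 0 < l) v hv
    have hb : ∀ f : H, ∀ t, 0 ≤ t → ‖⟪f, T t v⟫‖ ≤ ‖f‖ * ‖v‖ := fun f t ht =>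
      (norm_inner_le_norm _ _).trans (mul_le_mul_of_nonneg_left (hT t ht v) (norm_nonneg _))
    simp only [inner_add_left, map_add]
    rw [abelMean_add hl (hD f v hv) (hb f) (hD g v hv) (hb g), add_sub_add_comm]
    refine (norm_add_le _ _).trans ((add_le_add (h1 v hv) (h2 v hv)).trans_eq ?_)
    ring
  zero_mem' ε hε := by
    filter_upwards with l v _
    simp only [inner_zero_left, map_zero, sub_zero]
    have : abelMean l (fun _ => 0) = 0 := by simp [abelMean]
    rw [this, norm_zero]
    positivity
  smul_mem' c f hf ε hε := by
    have hc : 0 < ‖c‖ + 1 := by positivity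
    filter_upwards [hf (ε / (‖c‖ + 1)) (div_pos hε hc)] with l h v hv
    simp only [inner_smul_left, map_smul]
    rw [abelMean_const_mul, ← mul_sub, norm_mul, RCLike.norm_conj]
    calc _ ≤ (‖c‖ + 1) * (ε / (‖c‖ + 1) * ‖v‖) := by
          gcongr
          · linarith
          · exact h v hv
      _ = ε * ‖v‖ := by field_simp

lemma isClosed_abelSubspace (T : ℝ → H →L[ℂ] H) (D : Set H)
    (hT : ∀ t, 0 ≤ t → ∀ v, ‖T t v‖ ≤ ‖v‖)
    (hD : ∀ f, ∀ v ∈ D, ContinuousOn (fun t => ⟪f, T t v⟫) (Set.Ici 0)) :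
    IsClosed (abelSubspace T D hT hD : Set H) := by
  refine isClosed_of_closure_subset fun f hf ε hε => ?_
  obtain ⟨g, hg, hfg⟩ := Metric.mem_closure_iff.1 hf (ε / 3) (by positivity)
  rw [dist_eq_norm] at hfg
  filter_upwards [hg (ε / 3) (by positivity), self_mem_nhdsWithin] with l h (hl : 0 < l) v hv
  have hb : ∀ f : H, ∀ t, 0 ≤ t → ‖⟪f, T t v⟫‖ ≤ ‖f‖ * ‖v‖ := fun f t ht =>
    (norm_inner_le_norm _ _).trans (mul_le_mul_of_nonneg_left (hT t ht v) (norm_nonneg _))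
  have h1 : abelMean l (fun t => ⟪f, T t v⟫) =
      abelMean l (fun t => ⟪f - g, T t v⟫) + abelMean l (fun t => ⟪g, T t v⟫) := by
    rw [← abelMean_add hl (hD _ v hv) (hb _) (hD g v hv) (hb g)]
    refine abelMean_congr l fun t _ => ?_
    rw [← inner_add_left, sub_add_cancel]
  have h2 : ⟪(fixedSubspace T).starProjection f, v⟫ =
      ⟪(fixedSubspace T).starProjection (f - g), v⟫ + ⟪(fixedSubspace T).starProjection g, v⟫ := by
    rw [← inner_add_left, ← map_add, sub_add_cancel]
  have h3 : ‖⟪(fixedSubspace T).starProjection (f - g), v⟫‖ ≤ ‖f - g‖ * ‖v‖ :=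
    (norm_inner_le_norm _ _).trans
      (mul_le_mul_of_nonneg_right (Submodule.norm_starProjection_apply_le _ _) (norm_nonneg _))
  have h4 := norm_abelMean_le hl (hb (f - g))
  rw [h1, h2, add_sub_add_comm]
  calc _ ≤ (‖f - g‖ * ‖v‖ + ‖f - g‖ * ‖v‖) + ε / 3 * ‖v‖ :=
        (norm_add_le _ _).trans (add_le_add ((norm_sub_le _ _).trans (add_le_add h4 h3)) (h v hv))
    _ ≤ (ε / 3 * ‖v‖ + ε / 3 * ‖v‖) + ε / 3 * ‖v‖ := by gcongr
    _ = ε * ‖v‖ := by ring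

lemma fixedSubspace_le_abelSubspace (T : ℝ → H →L[ℂ] H) (D : Set H)
    (hT : ∀ t, 0 ≤ t → ∀ v, ‖T t v‖ ≤ ‖v‖)
    (hD : ∀ f, ∀ v ∈ D, ContinuousOn (fun t => ⟪f, T t v⟫) (Set.Ici 0)) :
    fixedSubspace T ≤ abelSubspace T D hT hD := by
  intro f hf ε hε
  filter_upwards [self_mem_nhdsWithin] with l (hl : 0 < l) v _
  have : abelMean l (fun t => ⟪f, T t v⟫) = ⟪f, v⟫ := by
    rw [← abelMean_const hl ⟪f, v⟫]
    refine abelMean_congr l fun t ht => ?_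
    rw [← ContinuousLinearMap.adjoint_inner_left,
      adjoint_apply_eq_self_of_apply_eq_self (hT t ht) (hf t ht)]
  rw [this, Submodule.starProjection_eq_self_iff.2 hf, sub_self, norm_zero]
  positivity

lemma sub_adjoint_mem_abelSubspace (T : ℝ → H →L[ℂ] H) (D : Set H)
    (hT : ∀ t, 0 ≤ t → ∀ v, ‖T t v‖ ≤ ‖v‖)
    (hD : ∀ f, ∀ v ∈ D, ContinuousOn (fun t => ⟪f, T t v⟫) (Set.Ici 0))
    (hadd : ∀ s t, 0 ≤ s → 0 ≤ t → ∀ v, T (s + t) v = T s (T t v))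
    {s : ℝ} (hs : 0 ≤ s) (h : H) : h - (T s).adjoint h ∈ abelSubspace T D hT hD := by
  intro ε hε
  have hP : (fixedSubspace T).starProjection (h - (T s).adjoint h) = 0 := by
    rw [Submodule.starProjection_apply_eq_zero_iff, Submodule.mem_orthogonal]
    intro v hv
    rw [inner_sub_right, ContinuousLinearMap.adjoint_inner_right, hv s hs, sub_self]
  have hlim : Tendsto (fun l : ℝ => (l * s + (Real.exp (l * s) - 1)) * ‖h‖) (𝓝[>] 0) (𝓝 0) := by
    have : Continuous fun l : ℝ => (l * s + (Real.exp (l * s) - 1)) * ‖h‖ := by fun_prop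
    have h0 := this.tendsto 0
    simp only [zero_mul, Real.exp_zero, sub_self, add_zero] at h0
    exact h0.mono_left nhdsWithin_le_nhds
  filter_upwards [hlim.eventually_lt_const hε, self_mem_nhdsWithin] with l h1 (hl : 0 < l) v hv
  have hb : ∀ t, 0 ≤ t → ‖⟪h, T t v⟫‖ ≤ ‖h‖ * ‖v‖ := fun t ht =>
    (norm_inner_le_norm _ _).trans (mul_le_mul_of_nonneg_left (hT t ht v) (norm_nonneg _))
  rw [hP, inner_zero_left, sub_zero]
  have h2 : abelMean l (fun t => ⟪h - (T s).adjoint h, T t v⟫) =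
      abelMean l (fun t => ⟪h, T t v⟫ - ⟪h, T (t + s) v⟫) := by
    refine abelMean_congr l fun t ht => ?_
    rw [inner_sub_left, ContinuousLinearMap.adjoint_inner_left, add_comm t s, hadd s t hs ht]
  rw [h2]
  refine (norm_abelMean_sub_shift_le hl hs (hD h v hv) hb).trans ?_
  rw [← mul_assoc]
  exact mul_le_mul_of_nonneg_right h1.le (norm_nonneg _)

lemma abelSubspace_eq_top (T : ℝ → H →L[ℂ] H) (D : Set H)
    (hT : ∀ t, 0 ≤ t → ∀ v, ‖T t v‖ ≤ ‖v‖)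
    (hD : ∀ f, ∀ v ∈ D, ContinuousOn (fun t => ⟪f, T t v⟫) (Set.Ici 0))
    (hadd : ∀ s t, 0 ≤ s → 0 ≤ t → ∀ v, T (s + t) v = T s (T t v)) :
    abelSubspace T D hT hD = ⊤ := by
  have : CompleteSpace (abelSubspace T D hT hD) :=
    (isClosed_abelSubspace T D hT hD).completeSpace_coe
  rw [← Submodule.orthogonal_eq_bot_iff, eq_bot_iff]
  intro v hv
  rw [Submodule.mem_orthogonal] at hv
  have hfix : v ∈ fixedSubspace T := fun t ht => by
    refine ext_inner_left ℂ fun h => ?_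
    have := hv _ (sub_adjoint_mem_abelSubspace T D hT hD hadd ht h)
    rw [inner_sub_left, ContinuousLinearMap.adjoint_inner_left, sub_eq_zero] at this
    exact this.symm
  exact inner_self_eq_zero.1 (hv v (fixedSubspace_le_abelSubspace T D hT hD hfix))

/-- The evaluation of the elements of a von Neumann algebra at a vector. -/
def orbitMap (M : VonNeumannAlgebra H) (ζ : H) : M.toStarSubalgebra →ₗ[ℂ] H where
  toFun x := (x : H →L[ℂ] H) ζ
  map_add' _ _ := rfl
  map_smul' _ _ := rfl

@[simp]
lemma orbitMap_apply (M : VonNeumannAlgebra H) (ζ : H) (x : M.toStarSubalgebra) :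
    orbitMap M ζ x = (x : H →L[ℂ] H) ζ := rfl

lemma IsCyclicVector.denseRange_orbitMap {M : VonNeumannAlgebra H} {ζ : H}
    (h : IsCyclicVector M ζ) : DenseRange (orbitMap M ζ) := by
  refine Dense.mono ?_ h
  rw [← LinearMap.coe_range, SetLike.coe_subset_coe, Submodule.span_le]
  rintro _ ⟨x, hx, rfl⟩
  exact ⟨⟨x, hx⟩, rfl⟩

lemma IsSeparatingVector.denseRange_orbitMap_commutant {M : VonNeumannAlgebra H} {ζ : H}
    (h : IsSeparatingVector M ζ) : DenseRange (orbitMap M.commutant ζ) := by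
  set K : Submodule ℂ H := (LinearMap.range (orbitMap M.commutant ζ)).topologicalClosure with hK
  have hKc : IsClosed (K : Set H) := Submodule.isClosed_topologicalClosure _
  have : CompleteSpace K := hKc.completeSpace_coe
  have hp : K.starProjection ∈ M := by
    rw [VonNeumannAlgebra.IsStarProjection.mem_iff isStarProjection_starProjection]
    intro y hy
    rw [Submodule.range_starProjection, Module.End.mem_invtSubmodule]
    refine Submodule.topologicalClosure_minimal _ ?_ (hKc.preimage y.continuous)
    rintro _ ⟨z, rfl⟩
    exact Submodule.le_topologicalClosure _ ⟨⟨y * z, mul_mem hy z.2⟩, rfl⟩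
  have hζ : ζ ∈ K := Submodule.le_topologicalClosure _ ⟨⟨1, one_mem _⟩, rfl⟩
  have h0 : (1 - K.starProjection : H →L[ℂ] H) = 0 := by
    refine h _ (sub_mem (one_mem M) hp) ?_
    simp [Submodule.starProjection_eq_self_iff.2 hζ]
  intro v
  have hv : v ∈ K := by
    rw [← Submodule.starProjection_eq_self_iff, ← sub_eq_zero.1 h0]
    rfl
  rw [hK, ← SetLike.mem_coe, Submodule.topologicalClosure_coe, LinearMap.coe_range] at hv
  exact hv

lemma VonNeumannAlgebra.sqrt_mem {M : VonNeumannAlgebra H} {x : H →L[ℂ] H} (hx : x ∈ M) :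
    CFC.sqrt x ∈ M := by
  rw [← M.commutant_commutant, VonNeumannAlgebra.mem_commutant_iff]
  intro y hy
  have hc : Commute x y := (VonNeumannAlgebra.mem_commutant_iff.1 hy x hx)
  exact (hc.cfcₙ_nnreal NNReal.sqrt).symm

/-- Complete positivity of a map on a von Neumann algebra. -/
def IsCompletelyPositiveOn (M : VonNeumannAlgebra H)
    (σ : (H →L[ℂ] H) →ₗ[ℂ] (H →L[ℂ] H)) : Prop :=
  ∀ n : ℕ, ∀ x : Fin n → (H →L[ℂ] H), (∀ i, x i ∈ M) →
    ∀ h : Fin n → H, 0 ≤ ∑ i, ∑ j, ⟪h i, σ (star (x i) * x j) (h j)⟫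

namespace IsCompletelyPositiveOn

variable {M : VonNeumannAlgebra H} {σ : (H →L[ℂ] H) →ₗ[ℂ] (H →L[ℂ] H)}

lemma inner_nonneg (hσ : IsCompletelyPositiveOn M σ) {x : H →L[ℂ] H} (hx : x ∈ M)
    (hp : x.IsPositive) (h : H) : 0 ≤ ⟪h, σ x h⟫ := by
  have hx0 : 0 ≤ x := (ContinuousLinearMap.nonneg_iff_isPositive x).2 hp
  have key := hσ 1 (fun _ => CFC.sqrt x) (fun _ => VonNeumannAlgebra.sqrt_mem hx) (fun _ => h)
  have hs : star (CFC.sqrt x) = CFC.sqrt x := (IsSelfAdjoint.of_nonneg (CFC.sqrt_nonneg x)).star_eq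
  simpa [hs, CFC.sqrt_mul_sqrt_self x hx0] using key

lemma re_inner_map_star (hσ : IsCompletelyPositiveOn M σ) (h1 : σ 1 = 1) {x : H →L[ℂ] H}
    (hx : x ∈ M) (h k : H) :
    (⟪k, σ (star x) h⟫).re = (⟪h, σ x k⟫).re := by
  have key := hσ 2 ![1, x] (fun i => by fin_cases i <;> simp [hx]) ![Complex.I • h, k]
  have hxx := (hσ 1 (fun _ => x) (fun _ => hx) (fun _ => k))
  simp only [Fin.sum_univ_two, Matrix.cons_val_zero, Matrix.cons_val_one, star_one, one_mul,
    mul_one, h1, Finset.univ_unique, Finset.sum_singleton] at key hxx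
  have k1 := (Complex.le_def.1 key).2
  have k2 := (Complex.le_def.1 hxx).2
  have k3 : (⟪h, h⟫).im = 0 := inner_self_im (𝕜 := ℂ) h
  simp only [Complex.add_im, one_apply_eq_self, k3, ← k2, Complex.zero_im, map_smul,
    inner_smul_left, inner_smul_right, Complex.mul_im, Complex.mul_re,
    Complex.conj_I, Complex.neg_re, Complex.neg_im, Complex.I_re, Complex.I_im] at k1
  linarith

lemma norm_sq_map_apply_le (hσ : IsCompletelyPositiveOn M σ) (h1 : σ 1 = 1) {x : H →L[ℂ] H}
    (hx : x ∈ M) (h : H) : ‖σ x h‖ ^ 2 ≤ (⟪h, σ (star x * x) h⟫).re := by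
  have key := hσ 2 ![1, x] (fun i => by fin_cases i <;> simp [hx]) ![-(σ x h), h]
  simp only [Fin.sum_univ_two, Matrix.cons_val_zero, Matrix.cons_val_one, star_one, one_mul,
    mul_one, h1] at key
  have k1 := (Complex.le_def.1 key).1
  have k2 := hσ.re_inner_map_star h1 hx (-(σ x h)) h
  have k3 : (⟪σ x h, σ x h⟫).re = ‖σ x h‖ ^ 2 := inner_self_eq_norm_sq (𝕜 := ℂ) _
  simp only [Complex.add_re, one_apply_eq_self, k2, inner_neg_left, inner_neg_right,
    neg_neg, Complex.neg_re, k3, Complex.zero_re] at k1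
  linarith

lemma norm_map_apply_le (hσ : IsCompletelyPositiveOn M σ) (h1 : σ 1 = 1) {x : H →L[ℂ] H}
    (hx : x ∈ M) (h : H) : ‖σ x h‖ ≤ ‖x‖ * ‖h‖ := by
  set y : H →L[ℂ] H := ((‖x‖ ^ 2 : ℝ) : ℂ) • 1 - star x * x with hy
  have hyM : y ∈ M := by
    refine sub_mem ?_ (mul_mem (star_mem hx) hx)
    exact M.toStarSubalgebra.smul_mem (one_mem _) _
  have hyp : y.IsPositive := by
    rw [ContinuousLinearMap.isPositive_def']
    refine ⟨?_, fun v => ?_⟩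
    · rw [IsSelfAdjoint, hy]
      simp
    · rw [ContinuousLinearMap.reApplyInnerSelf_apply]
      have e : (⟪y v, v⟫) = ((‖x‖ ^ 2 : ℝ) : ℂ) * ⟪v, v⟫ - ⟪x v, x v⟫ := by
        rw [hy, sub_apply, inner_sub_left, smul_apply, inner_smul_left,
          Complex.conj_ofReal, one_apply_eq_self, mul_apply_eq_comp,
          ContinuousLinearMap.star_eq_adjoint, ContinuousLinearMap.adjoint_inner_left]
      have e2 := pow_le_pow_left₀ (norm_nonneg _) (x.le_opNorm v) 2
      rw [e, inner_self_eq_norm_sq_to_K, inner_self_eq_norm_sq_to_K]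
      simp only [RCLike.re_to_complex, Complex.coe_algebraMap, ← Complex.ofReal_pow,
        ← Complex.ofReal_mul, ← Complex.ofReal_sub, Complex.ofReal_re]
      linarith [mul_pow ‖x‖ ‖v‖ 2]
  have k1 := (Complex.le_def.1 (hσ.inner_nonneg hyM hyp h)).1
  have k2 := hσ.norm_sq_map_apply_le h1 hx h
  have k3 : (⟪h, h⟫).re = ‖h‖ ^ 2 := inner_self_eq_norm_sq (𝕜 := ℂ) _
  rw [hy, map_sub, map_smul, h1, sub_apply, inner_sub_right, smul_apply,
    inner_smul_right, one_apply_eq_self, Complex.sub_re, Complex.re_ofReal_mul, k3,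
    Complex.zero_re] at k1
  refine le_of_sq_le_sq ?_ (by positivity)
  rw [mul_pow]
  linarith

lemma norm_map_apply_le_of_invariant (hσ : IsCompletelyPositiveOn M σ) (h1 : σ 1 = 1) {ζ : H}
    (hinv : ∀ x ∈ M, ⟪ζ, σ x ζ⟫ = ⟪ζ, x ζ⟫) {x : H →L[ℂ] H} (hx : x ∈ M) :
    ‖σ x ζ‖ ≤ ‖x ζ‖ := by
  have k := hσ.norm_sq_map_apply_le h1 hx ζ
  have k3 : (⟪x ζ, x ζ⟫).re = ‖x ζ‖ ^ 2 := inner_self_eq_norm_sq (𝕜 := ℂ) _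
  rw [hinv _ (mul_mem (star_mem hx) hx), mul_apply_eq_comp,
    ContinuousLinearMap.star_eq_adjoint, ContinuousLinearMap.adjoint_inner_right, k3] at k
  exact le_of_sq_le_sq k (norm_nonneg _)

end IsCompletelyPositiveOn

lemma isPositive_of_inner_nonneg {z : H →L[ℂ] H} (h : ∀ v, 0 ≤ ⟪v, z v⟫) : z.IsPositive := by
  have key : ∀ v, 0 ≤ ⟪z v, v⟫ := fun v => by
    have hv := h v
    rwa [← inner_conj_symm, Complex.conj_eq_iff_im.2 (Complex.nonneg_iff.1 hv).2.symm]
  rw [ContinuousLinearMap.isPositive_iff_complex]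
  intro v
  obtain ⟨h1, h2⟩ := Complex.nonneg_iff.1 (key v)
  exact ⟨Complex.ext rfl h2, h1⟩

/-- A pointwise weakly continuous semigroup of unital completely positive maps on a von Neumann
algebra that leaves the vector functional of `ζ` invariant. -/
structure IsInvariantCPSemigroup (M : VonNeumannAlgebra H) (ζ : H)
    (τ : ℝ → (H →L[ℂ] H) →ₗ[ℂ] (H →L[ℂ] H)) : Prop where
  map_add : ∀ s t : ℝ, 0 ≤ s → 0 ≤ t → ∀ x : H →L[ℂ] H, τ (s + t) x = τ s (τ t x)
  map_mem : ∀ t : ℝ, 0 ≤ t → ∀ x ∈ M, τ t x ∈ M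
  map_one : ∀ t : ℝ, 0 ≤ t → τ t (1 : H →L[ℂ] H) = 1
  completelyPositive : ∀ t : ℝ, 0 ≤ t → IsCompletelyPositiveOn M (τ t)
  invariant : ∀ t : ℝ, 0 ≤ t → ∀ x ∈ M, ⟪ζ, τ t x ζ⟫ = ⟪ζ, x ζ⟫
  continuousOn : ∀ f g : H, ∀ x ∈ M, ContinuousOn (fun t : ℝ => ⟪f, τ t x g⟫) (Set.Ici 0)

namespace IsInvariantCPSemigroup

variable {M : VonNeumannAlgebra H} {ζ : H} {τ : ℝ → (H →L[ℂ] H) →ₗ[ℂ] (H →L[ℂ] H)}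

lemma norm_inner_le (hτ : IsInvariantCPSemigroup M ζ τ) {x : H →L[ℂ] H} (hx : x ∈ M) (f g : H)
    (t : ℝ) (ht : 0 ≤ t) : ‖⟪f, τ t x g⟫‖ ≤ ‖f‖ * (‖x‖ * ‖g‖) :=
  (norm_inner_le_norm _ _).trans (mul_le_mul_of_nonneg_left
    ((hτ.completelyPositive t ht).norm_map_apply_le (hτ.map_one t ht) hx g) (norm_nonneg _))

/-- The Abel means of the semigroup, evaluated at `ζ`, converge to a projection onto
the vectors which are fixed by the induced contraction semigroup. -/
lemma exists_abelLimit (hτ : IsInvariantCPSemigroup M ζ τ) (hcyc : IsCyclicVector M ζ)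
    (hsep : IsSeparatingVector M ζ) : ∃ P : H →L[ℂ] H,
      (∀ x z : H →L[ℂ] H, z ∈ M → P (x ζ) = z ζ → ∀ t, 0 ≤ t → τ t z = z) ∧
      (∀ x ∈ M, (∀ t, 0 ≤ t → τ t x = x) → P (x ζ) = x ζ) ∧
      ∀ f, ∀ ε > (0 : ℝ), ∀ᶠ l in 𝓝[>] (0 : ℝ), ∀ x ∈ M,
        ‖abelMean l (fun t => ⟪f, τ t x ζ⟫) - ⟪f, P (x ζ)⟫‖ ≤ ε * ‖x ζ‖ := by
  set e := orbitMap M ζ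
  have he : DenseRange e := hcyc.denseRange_orbitMap
  set T₀ : ℝ → M.toStarSubalgebra →ₗ[ℂ] H := fun t =>
    (ContinuousLinearMap.apply ℂ H ζ).toLinearMap ∘ₗ τ t ∘ₗ M.toStarSubalgebra.toSubmodule.subtype
  set T : ℝ → H →L[ℂ] H := fun t => (T₀ t).extendOfNorm e
  have hb : ∀ t, 0 ≤ t → ∀ x, ‖T₀ t x‖ ≤ 1 * ‖e x‖ := fun t ht x => by
    rw [one_mul]
    exact (hτ.completelyPositive t ht).norm_map_apply_le_of_invariant (hτ.map_one t ht)
      (hτ.invariant t ht) x.2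
  have hTe : ∀ t, 0 ≤ t → ∀ x ∈ M, T t (x ζ) = τ t x ζ := fun t ht x hx =>
    LinearMap.extendOfNorm_eq he ⟨1, hb t ht⟩ (⟨x, hx⟩ : M.toStarSubalgebra)
  have hT : ∀ t, 0 ≤ t → ∀ v, ‖T t v‖ ≤ ‖v‖ := fun t ht v => by
    simpa using LinearMap.norm_extendOfNorm_apply_le he 1 (hb t ht) v
  have hadd : ∀ s t, 0 ≤ s → 0 ≤ t → ∀ v, T (s + t) v = T s (T t v) := by
    intro s t hs ht v
    refine congrFun (he.equalizer (T (s + t)).continuous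
      ((T s).continuous.comp (T t).continuous) (funext fun x => ?_)) v
    change T (s + t) ((x : H →L[ℂ] H) ζ) = T s (T t ((x : H →L[ℂ] H) ζ))
    rw [hTe _ (add_nonneg hs ht) _ x.2, hTe t ht _ x.2, hTe s hs _ (hτ.map_mem t ht _ x.2),
      hτ.map_add s t hs ht]
  set D : Set H := {v | ∃ x ∈ M, v = x ζ}
  have hD : ∀ f, ∀ v ∈ D, ContinuousOn (fun t => ⟪f, T t v⟫) (Set.Ici 0) := by
    rintro f _ ⟨x, hx, rfl⟩
    refine (hτ.continuousOn f ζ x hx).congr fun t ht => ?_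
    simp only [hTe t ht x hx]
  refine ⟨(fixedSubspace T).starProjection, fun x z hz hxz t ht => ?_, fun x hx hfix => ?_,
    fun f ε hε => ?_⟩
  · have hmem : z ζ ∈ fixedSubspace T := hxz ▸ Submodule.starProjection_apply_mem _ _
    have h := hmem t ht
    rw [hTe t ht z hz] at h
    refine sub_eq_zero.1 (hsep _ (sub_mem (hτ.map_mem t ht z hz) hz) ?_)
    rw [sub_apply, h, sub_self]
  · rw [Submodule.starProjection_eq_self_iff]
    intro t ht
    rw [hTe t ht x hx, hfix t ht]
  · have hf : f ∈ abelSubspace T D hT hD := by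
      rw [abelSubspace_eq_top T D hT hD hadd]
      trivial
    filter_upwards [hf ε hε] with l h x hx
    have h' := h (x ζ) ⟨x, hx, rfl⟩
    rw [Submodule.inner_starProjection_left_eq_right] at h'
    rwa [abelMean_congr l fun t ht => by rw [hTe t ht x hx]] at h'

variable {P : H →L[ℂ] H}

lemma abelMean_commutant (hτ : IsInvariantCPSemigroup M ζ τ) {x y : H →L[ℂ] H} (hx : x ∈ M)
    (hy : y ∈ M.commutant) (f : H) (l : ℝ) :
    abelMean l (fun t => ⟪f, τ t x (y ζ)⟫) = abelMean l (fun t => ⟪y.adjoint f, τ t x ζ⟫) := by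
  refine abelMean_congr l fun t ht => ?_
  have h := VonNeumannAlgebra.mem_commutant_iff.1 hy _ (hτ.map_mem t ht x hx)
  rw [ContinuousLinearMap.adjoint_inner_left, ← mul_apply_eq_comp, h, mul_apply_eq_comp]

lemma exists_apply_eq (hτ : IsInvariantCPSemigroup M ζ τ) (hsep : IsSeparatingVector M ζ)
    (hP : ∀ f, ∀ ε > (0 : ℝ), ∀ᶠ l in 𝓝[>] (0 : ℝ), ∀ x ∈ M,
      ‖abelMean l (fun t => ⟪f, τ t x ζ⟫) - ⟪f, P (x ζ)⟫‖ ≤ ε * ‖x ζ‖)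
    {x : H →L[ℂ] H} (hx : x ∈ M) : ∃ z ∈ M, z ζ = P (x ζ) ∧ ‖z‖ ≤ ‖x‖ := by
  set e := orbitMap M.commutant ζ
  have he : DenseRange e := hsep.denseRange_orbitMap_commutant
  set f₀ : M.commutant.toStarSubalgebra →ₗ[ℂ] H := orbitMap M.commutant (P (x ζ))
  have hlim : ∀ f, Tendsto (fun l => abelMean l (fun t => ⟪f, τ t x ζ⟫)) (𝓝[>] 0)
      (𝓝 ⟪f, P (x ζ)⟫) := fun f => by
    rw [Metric.tendsto_nhds]
    intro ε hε
    filter_upwards [hP f (ε / (‖x ζ‖ + 1)) (by positivity)] with l h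
    rw [dist_eq_norm]
    refine (h x hx).trans_lt ?_
    rw [div_mul_eq_mul_div, div_lt_iff₀ (by positivity)]
    linarith
  have hb : ∀ y, ‖f₀ y‖ ≤ ‖x‖ * ‖e y‖ := fun y => by
    have key : ∀ f, ‖⟪f, f₀ y⟫‖ ≤ ‖f‖ * (‖x‖ * ‖e y‖) := fun f => by
      have h := (hlim ((y : H →L[ℂ] H).adjoint f)).norm
      rw [ContinuousLinearMap.adjoint_inner_left] at h
      refine le_of_tendsto h ?_
      filter_upwards [self_mem_nhdsWithin] with l (hl : 0 < l)
      rw [← hτ.abelMean_commutant hx y.2]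
      exact norm_abelMean_le hl (hτ.norm_inner_le hx f _)
    have h := key (f₀ y)
    rw [inner_self_eq_norm_sq_to_K, norm_pow, RCLike.norm_ofReal, abs_norm, sq] at h
    by_cases h0 : ‖f₀ y‖ = 0
    · rw [h0]; positivity
    · exact le_of_mul_le_mul_left h (lt_of_le_of_ne (norm_nonneg _) (Ne.symm h0))
  set z := f₀.extendOfNorm e
  have hz : ∀ y ∈ M.commutant, z (y ζ) = y (P (x ζ)) := fun y hy =>
    LinearMap.extendOfNorm_eq he ⟨_, hb⟩ (⟨y, hy⟩ : M.commutant.toStarSubalgebra)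
  refine ⟨z, ?_, by simpa using hz 1 (one_mem _),
    LinearMap.opNorm_extendOfNorm_le he (norm_nonneg _) hb⟩
  rw [← M.commutant_commutant, VonNeumannAlgebra.mem_commutant_iff]
  intro y hy
  refine ContinuousLinearMap.ext fun v => congrFun (he.equalizer (y * z).continuous
    (z * y).continuous (funext fun w => ?_)) v
  change y (z ((w : H →L[ℂ] H) ζ)) = z ((y * w : H →L[ℂ] H) ζ)
  rw [hz _ w.2, hz _ (mul_mem hy w.2)]
  rfl

lemma eventually_norm_abelMean_sub_le (hτ : IsInvariantCPSemigroup M ζ τ) (hζ : ‖ζ‖ = 1)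
    (hsep : IsSeparatingVector M ζ)
    (hP : ∀ f, ∀ ε > (0 : ℝ), ∀ᶠ l in 𝓝[>] (0 : ℝ), ∀ x ∈ M,
      ‖abelMean l (fun t => ⟪f, τ t x ζ⟫) - ⟪f, P (x ζ)⟫‖ ≤ ε * ‖x ζ‖)
    (f g : H) {ε : ℝ} (hε : 0 < ε) :
    ∀ᶠ l in 𝓝[>] (0 : ℝ), ∀ x ∈ M, ∀ z ∈ M, z ζ = P (x ζ) → ‖z‖ ≤ ‖x‖ →
      ‖abelMean l (fun t => ⟪f, τ t x g⟫) - ⟪f, z g⟫‖ ≤ ε * ‖x‖ := by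
  obtain ⟨⟨y, hy⟩, hyg⟩ := hsep.denseRange_orbitMap_commutant.exists_dist_lt g
    (ε := ε / 3 / (‖f‖ + 1)) (by positivity)
  replace hyg : ‖g - y ζ‖ < ε / 3 / (‖f‖ + 1) := by rwa [← dist_eq_norm]
  have hfg : ‖f‖ * ‖g - y ζ‖ ≤ ε / 3 := by
    rw [lt_div_iff₀ (by positivity)] at hyg
    nlinarith [norm_nonneg (g - y ζ)]
  filter_upwards [hP (y.adjoint f) (ε / 3) (by positivity), self_mem_nhdsWithin]
    with l h (hl : 0 < l) x hx z hz hzx hzn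
  have h1 : abelMean l (fun t => ⟪f, τ t x g⟫) = abelMean l (fun t => ⟪f, τ t x (g - y ζ)⟫) +
      abelMean l (fun t => ⟪f, τ t x (y ζ)⟫) := by
    rw [← abelMean_add hl (hτ.continuousOn _ _ x hx) (hτ.norm_inner_le hx _ _)
      (hτ.continuousOn _ _ x hx) (hτ.norm_inner_le hx _ _)]
    refine abelMean_congr l fun t _ => ?_
    rw [← inner_add_right, ← _root_.map_add, sub_add_cancel]
  have h2 : ⟪f, z g⟫ = ⟪f, z (g - y ζ)⟫ + ⟪y.adjoint f, P (x ζ)⟫ := by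
    have hc := VonNeumannAlgebra.mem_commutant_iff.1 hy z hz
    rw [ContinuousLinearMap.adjoint_inner_left, ← hzx, ← mul_apply_eq_comp y z, ← hc,
      mul_apply_eq_comp, ← inner_add_right, ← _root_.map_add, sub_add_cancel]
  have h3 : ‖⟪f, z (g - y ζ)⟫‖ ≤ ‖f‖ * (‖x‖ * ‖g - y ζ‖) :=
    (norm_inner_le_norm _ _).trans (mul_le_mul_of_nonneg_left (z.le_of_opNorm_le hzn _)
      (norm_nonneg _))
  have h4 := norm_abelMean_le hl (hτ.norm_inner_le hx f (g - y ζ))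
  have h5 : ‖x ζ‖ ≤ ‖x‖ := by simpa [hζ] using x.le_opNorm ζ
  have h6 : ‖f‖ * (‖x‖ * ‖g - y ζ‖) ≤ ε / 3 * ‖x‖ := by
    calc _ = ‖f‖ * ‖g - y ζ‖ * ‖x‖ := by ring
      _ ≤ _ := mul_le_mul_of_nonneg_right hfg (norm_nonneg _)
  rw [h1, h2, hτ.abelMean_commutant hx hy, add_sub_add_comm]
  calc _ ≤ (ε / 3 * ‖x‖ + ε / 3 * ‖x‖) + ε / 3 * ‖x ζ‖ :=
        (norm_add_le _ _).trans (add_le_add ((norm_sub_le _ _).trans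
          (add_le_add (h4.trans h6) (h3.trans h6))) (h x hx))
    _ ≤ (ε / 3 * ‖x‖ + ε / 3 * ‖x‖) + ε / 3 * ‖x‖ := by gcongr
    _ = ε * ‖x‖ := by ring

end IsInvariantCPSemigroup

theorem stmt13 (M : VonNeumannAlgebra H) (ζ : H) (hζ : ‖ζ‖ = 1)
    (hcyc : IsCyclicVector M ζ) (hsep : IsSeparatingVector M ζ)
    (τ : ℝ → (H →L[ℂ] H) →ₗ[ℂ] (H →L[ℂ] H))
    -- semigroup property:
    (hid : τ 0 = LinearMap.id)
    (hsemi : ∀ s t : ℝ, 0 ≤ s → 0 ≤ t → ∀ x : H →L[ℂ] H, τ (s + t) x = τ s (τ t x))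
    -- each `τ t` maps `M` to `M` and is unital:
    (hmem : ∀ t : ℝ, 0 ≤ t → ∀ x ∈ M, τ t x ∈ M)
    (hunital : ∀ t : ℝ, 0 ≤ t → τ t (1 : H →L[ℂ] H) = 1)
    -- complete positivity:
    (hcp : ∀ t : ℝ, 0 ≤ t → ∀ n : ℕ, ∀ x : Fin n → (H →L[ℂ] H), (∀ i, x i ∈ M) →
      ∀ h : Fin n → H, 0 ≤ ∑ i, ∑ j, ⟪h i, τ t (star (x i) * x j) (h j)⟫)
    -- invariance of `φ`:
    (hinv : ∀ t : ℝ, 0 ≤ t → ∀ x ∈ M, ⟪ζ, τ t x ζ⟫ = ⟪ζ, x ζ⟫)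
    -- continuity in `t`:
    (hcont : ∀ f g : H, ∀ x ∈ M, ContinuousOn (fun t : ℝ => ⟪f, τ t x g⟫) (Set.Ici 0)) :
    ∃ E : (H →L[ℂ] H) →ₗ[ℂ] (H →L[ℂ] H),
      (∀ x ∈ M, E x ∈ M) ∧
      (∀ x ∈ M, x.IsPositive → (E x).IsPositive) ∧
      E (1 : H →L[ℂ] H) = 1 ∧
      (∀ x ∈ M, E (E x) = E x) ∧
      (∀ x ∈ M, ∀ t : ℝ, 0 ≤ t → τ t (E x) = E x) ∧
      (∀ x ∈ M, (∀ t : ℝ, 0 ≤ t → τ t x = x) → E x = x) ∧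
      ∀ f g : H, ∀ ε > (0 : ℝ), ∃ δ > (0 : ℝ), ∀ l : ℝ, 0 < l → l < δ →
        ∀ x ∈ M, ‖x‖ ≤ 1 →
          ‖(l : ℂ) * (∫ t in Set.Ioi (0 : ℝ), (Real.exp (-(l * t)) : ℂ) * ⟪f, τ t x g⟫) -
            ⟪f, E x g⟫‖ < ε := by
  have hτ : IsInvariantCPSemigroup M ζ τ := ⟨hsemi, hmem, hunital, hcp, hinv, hcont⟩
  obtain ⟨P, hPfix, hPid, hP⟩ := hτ.exists_abelLimit hcyc hsep
  choose! E₀ hE₀M hE₀ζ hE₀n using fun x (hx : x ∈ M) => hτ.exists_apply_eq hsep hP hx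
  have huniq : ∀ y ∈ M, ∀ z ∈ M, y ζ = z ζ → y = z := fun y hy z hz h =>
    sub_eq_zero.1 (hsep _ (sub_mem hy hz) (by rw [sub_apply, h, sub_self]))
  have hsmul : ∀ (c : ℂ), ∀ x ∈ M, c • x ∈ M := fun c x hx => M.toStarSubalgebra.smul_mem hx c
  let E₁ : M.toStarSubalgebra.toSubmodule →ₗ[ℂ] (H →L[ℂ] H) :=
    { toFun := fun x => E₀ x
      map_add' := fun x y => huniq _ (hE₀M _ (add_mem x.2 y.2)) _
        (add_mem (hE₀M _ x.2) (hE₀M _ y.2)) (by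
          rw [add_apply, hE₀ζ _ x.2, hE₀ζ _ y.2]
          refine (hE₀ζ _ (add_mem x.2 y.2)).trans ?_
          rw [add_apply, map_add])
      map_smul' := fun c x => huniq _ (hE₀M _ (hsmul c _ x.2)) _ (hsmul c _ (hE₀M _ x.2)) (by
          rw [smul_apply, hE₀ζ _ x.2]
          refine (hE₀ζ _ (hsmul c _ x.2)).trans ?_
          rw [smul_apply, map_smul, RingHom.id_apply]) }
  obtain ⟨E, hE⟩ := LinearMap.exists_extend E₁
  have hEx : ∀ x ∈ M, E x = E₀ x := fun x hx =>
    LinearMap.congr_fun hE (⟨x, hx⟩ : M.toStarSubalgebra.toSubmodule)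
  have hEfix : ∀ x ∈ M, (∀ t : ℝ, 0 ≤ t → τ t x = x) → E x = x := fun x hx h => by
    rw [hEx x hx]
    exact huniq _ (hE₀M x hx) _ hx ((hE₀ζ x hx).trans (hPid x hx h))
  have hτE : ∀ x ∈ M, ∀ t : ℝ, 0 ≤ t → τ t (E x) = E x := fun x hx => by
    rw [hEx x hx]
    exact hPfix x _ (hE₀M x hx) (hE₀ζ x hx).symm
  have hEM : ∀ x ∈ M, E x ∈ M := fun x hx => hEx x hx ▸ hE₀M x hx
  have hlim : ∀ f g : H, ∀ ε > (0 : ℝ), ∀ᶠ l in 𝓝[>] (0 : ℝ), ∀ x ∈ M,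
      ‖abelMean l (fun t => ⟪f, τ t x g⟫) - ⟪f, E x g⟫‖ ≤ ε * ‖x‖ := fun f g ε hε => by
    filter_upwards [hτ.eventually_norm_abelMean_sub_le hζ hsep hP f g hε] with l h x hx
    rw [hEx x hx]
    exact h x hx _ (hE₀M x hx) (hE₀ζ x hx) (hE₀n x hx)
  refine ⟨E, hEM, fun x hx hpos => isPositive_of_inner_nonneg fun v => ?_,
    hEfix 1 (one_mem _) hunital, fun x hx => hEfix _ (hEM x hx) (hτE x hx), hτE, hEfix,
    fun f g ε hε => ?_⟩
  · have ht : Tendsto (fun l => abelMean l (fun t => ⟪v, τ t x v⟫)) (𝓝[>] 0) (𝓝 ⟪v, E x v⟫) := by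
      rw [Metric.tendsto_nhds]
      intro ε hε
      filter_upwards [hlim v v (ε / (‖x‖ + 1)) (by positivity)] with l h
      rw [dist_eq_norm]
      refine (h x hx).trans_lt ?_
      rw [div_mul_eq_mul_div, div_lt_iff₀ (by positivity)]
      linarith
    refine ge_of_tendsto ht ?_
    filter_upwards [self_mem_nhdsWithin] with l (hl : 0 < l)
    exact abelMean_nonneg hl fun t ht => (hτ.completelyPositive t ht).inner_nonneg hx hpos v
  · obtain ⟨δ, hδ, h⟩ := Metric.mem_nhdsWithin_iff.1 (hlim f g (ε / 2) (half_pos hε))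
    refine ⟨δ, hδ, fun l hl hlδ x hx hx1 => ?_⟩
    have := h ⟨by simpa [abs_of_pos hl] using hlδ, hl⟩ x hx
    refine this.trans_lt ?_
    calc ε / 2 * ‖x‖ ≤ ε / 2 * 1 := by gcongr
      _ < ε := by linarith
end
end
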